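/- The satisfiability problem for PoCTL is decidable: for a fixed finite set AP of atomic propositions, there is a computable total function which, given a PoCTL formula Λ over AP (all interval bounds rational), returns true if Λ is satisfiable and false otherwise. -/

import Mathlib

open Set

/-- An interval `J ⊆ [0,1]` with rational bounds. -/
inductive RatInterval : Type where
  | icc (u v : ℚ)
  | ioc (u v : ℚ)
  | ico (u v : ℚ)
  | ioo (u v : ℚ)
  deriving DecidableEq

/-- Membership of a real number in a rational-bounded interval. -/
def RatInterval.mem : RatInterval → ℝ → Prop
  | .icc u v, x => (u : ℝ) ≤ x ∧ x ≤ (v : ℝ)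
  | .ioc u v, x => (u : ℝ) < x ∧ x ≤ (v : ℝ)
  | .ico u v, x => (u : ℝ) ≤ x ∧ x < (v : ℝ)
  | .ioo u v, x => (u : ℝ) < x ∧ x < (v : ℝ)

mutual
/-- PoCTL state formulae (including the derived connective `∨`, the necessity
operator `Ne_J`, and in path formulae the operators `𝐑`, `◇`). -/
inductive SF (A : Type) : Type where
  | tt : SF A
  | atom : A → SF A
  | and : SF A → SF A → SF A
  | or : SF A → SF A → SF A
  | not : SF A → SF A
  | po : RatInterval → PF A → SF A
  | ne : RatInterval → PF A → SF A

/-- PoCTL path formulae. -/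
inductive PF (A : Type) : Type where
  | next : SF A → PF A
  | untl : SF A → SF A → PF A
  | buntl : ℕ → SF A → SF A → PF A
  | rel : SF A → SF A → PF A
  | ev : SF A → PF A
  | box : SF A → PF A
end

/-- `Po_{≥r}(φ)`. -/
def poGe {A : Type} (r : ℚ) (φ : PF A) : SF A := .po (.icc r 1) φ
/-- `Po_{>r}(φ)`. -/
def poGt {A : Type} (r : ℚ) (φ : PF A) : SF A := .po (.ioc r 1) φ
/-- `Po_{≤r}(φ)`. -/
def poLe {A : Type} (r : ℚ) (φ : PF A) : SF A := .po (.icc 0 r) φ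
/-- `Po_{<r}(φ)`. -/
def poLt {A : Type} (r : ℚ) (φ : PF A) : SF A := .po (.ico 0 r) φ
/-- `Ne_{≥r}(φ)`. -/
def neGe {A : Type} (r : ℚ) (φ : PF A) : SF A := .ne (.icc r 1) φ
/-- `Ne_{>r}(φ)`. -/
def neGt {A : Type} (r : ℚ) (φ : PF A) : SF A := .ne (.ioc r 1) φ
/-- `Ne_{≤r}(φ)`. -/
def neLe {A : Type} (r : ℚ) (φ : PF A) : SF A := .ne (.icc 0 r) φ
/-- `Ne_{<r}(φ)`. -/
def neLt {A : Type} (r : ℚ) (φ : PF A) : SF A := .ne (.ico 0 r) φ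
/-- A possibilistic Kripke structure over states `S` and atomic propositions `A`. -/
structure PKS (S A : Type) where
  P : S → S → ℝ
  init : S → ℝ
  L : S → Set A
  countable : Countable S
  nonempty : Nonempty S
  P_nonneg : ∀ s t, 0 ≤ P s t
  P_le_one : ∀ s t, P s t ≤ 1
  P_sup : ∀ s, (⨆ t, P s t) = 1
  init_nonneg : ∀ s, 0 ≤ init s
  init_le_one : ∀ s, init s ≤ 1
  init_sup : (⨆ s, init s) = 1

variable {S A : Type}

/-- `π` is a path of `M`: all transition possibilities along `π` are positive. -/
def PKS.IsPath (M : PKS S A) (π : ℕ → S) : Prop := ∀ i, 0 < M.P (π i) (π (i + 1))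

/-- The set of all paths of `M`. -/
def PKS.Paths (M : PKS S A) : Set (ℕ → S) := {π | M.IsPath π}

/-- `Po^{M_s}(π) = inf { P(sᵢ,sᵢ₊₁) : i ≥ 0 }`, the possibility of a path in the
structure with unique initial state `π 0`. -/
noncomputable def PKS.poPathFrom (M : PKS S A) (π : ℕ → S) : ℝ :=
  ⨅ i, M.P (π i) (π (i + 1))

mutual
/-- Satisfaction of PoCTL state formulae at a state of a PKS. -/
def SF.Sat (M : PKS S A) (s : S) : SF A → Prop
  | .tt => True
  | .atom a => a ∈ M.L s
  | .and Φ Ψ => SF.Sat M s Φ ∧ SF.Sat M s Ψ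
  | .or Φ Ψ => SF.Sat M s Φ ∨ SF.Sat M s Ψ
  | .not Φ => ¬ SF.Sat M s Φ
  | .po J φ => J.mem (sSup {x : ℝ | ∃ π : ℕ → S,
      M.IsPath π ∧ π 0 = s ∧ PF.Sat M π φ ∧ x = M.poPathFrom π})
  | .ne J φ => J.mem (1 - sSup {x : ℝ | ∃ π : ℕ → S,
      M.IsPath π ∧ π 0 = s ∧ ¬ PF.Sat M π φ ∧ x = M.poPathFrom π})

/-- Satisfaction of PoCTL path formulae along a path of a PKS. -/
def PF.Sat (M : PKS S A) (π : ℕ → S) : PF A → Prop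
  | .next Φ => SF.Sat M (π 1) Φ
  | .untl Φ Ψ => ∃ k, SF.Sat M (π k) Ψ ∧ ∀ i < k, SF.Sat M (π i) Φ
  | .buntl n Φ Ψ => ∃ k ≤ n, SF.Sat M (π k) Ψ ∧ ∀ i < k, SF.Sat M (π i) Φ
  | .rel Φ Ψ => ∀ j, ¬ SF.Sat M (π j) Ψ → ∃ k < j, SF.Sat M (π k) Φ
  | .ev Φ => ∃ j, SF.Sat M (π j) Φ
  | .box Φ => ∀ j, SF.Sat M (π j) Φ
end

/-- Equivalence of PoCTL state formulae: same truth value at every state of every PKS. -/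
def SFEquiv {A : Type} (Φ Ψ : SF A) : Prop :=
  ∀ (S : Type) (M : PKS S A) (s : S), SF.Sat M s Φ ↔ SF.Sat M s Ψ
/-- `Φ` is satisfiable: it holds at some state of some PKS. -/
def SFSatisfiable {A : Type} (Φ : SF A) : Prop :=
  ∃ (S : Type) (M : PKS S A) (s : S), SF.Sat M s Φ

/-- A concrete numerical encoding of rational-bounded intervals. -/
def RatInterval.code : RatInterval → ℕ
  | .icc u v => Nat.pair 0 (Nat.pair (Encodable.encode u) (Encodable.encode v))
  | .ioc u v => Nat.pair 1 (Nat.pair (Encodable.encode u) (Encodable.encode v))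
  | .ico u v => Nat.pair 2 (Nat.pair (Encodable.encode u) (Encodable.encode v))
  | .ioo u v => Nat.pair 3 (Nat.pair (Encodable.encode u) (Encodable.encode v))

mutual
/-- A concrete numerical encoding of PoCTL state formulae. -/
def SF.code {A : Type} [Encodable A] : SF A → ℕ
  | .tt => Nat.pair 0 0
  | .atom a => Nat.pair 1 (Encodable.encode a)
  | .and Φ Ψ => Nat.pair 2 (Nat.pair Φ.code Ψ.code)
  | .or Φ Ψ => Nat.pair 3 (Nat.pair Φ.code Ψ.code)
  | .not Φ => Nat.pair 4 Φ.code
  | .po J φ => Nat.pair 5 (Nat.pair J.code φ.code)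
  | .ne J φ => Nat.pair 6 (Nat.pair J.code φ.code)

/-- A concrete numerical encoding of PoCTL path formulae. -/
def PF.code {A : Type} [Encodable A] : PF A → ℕ
  | .next Φ => Nat.pair 0 Φ.code
  | .untl Φ Ψ => Nat.pair 1 (Nat.pair Φ.code Ψ.code)
  | .buntl n Φ Ψ => Nat.pair 2 (Nat.pair n (Nat.pair Φ.code Ψ.code))
  | .rel Φ Ψ => Nat.pair 3 (Nat.pair Φ.code Ψ.code)
  | .ev Φ => Nat.pair 4 Φ.code
  | .box Φ => Nat.pair 5 Φ.code
end

/-! ### Numerical codes of formulae -/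

/-- The constructor tag of a code. -/
def tagOf (n : ℕ) : ℕ := n.unpair.1
/-- The argument of a code. -/
def argOf (n : ℕ) : ℕ := n.unpair.2
/-- The first component of the argument of a code. -/
def arg₁ (n : ℕ) : ℕ := (argOf n).unpair.1
/-- The second component of the argument of a code. -/
def arg₂ (n : ℕ) : ℕ := (argOf n).unpair.2

lemma argOf_le (n : ℕ) : argOf n ≤ n := Nat.unpair_right_le n
lemma arg₁_le (n : ℕ) : arg₁ n ≤ n := (Nat.unpair_left_le _).trans (argOf_le n)
lemma arg₂_le (n : ℕ) : arg₂ n ≤ n := (Nat.unpair_right_le _).trans (argOf_le n)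

lemma argOf_lt {n : ℕ} (h : tagOf n ≠ 0) : argOf n < n := by
  have h1 := Nat.add_le_pair n.unpair.1 n.unpair.2
  rw [Nat.pair_unpair] at h1
  unfold tagOf at h
  unfold argOf
  omega

lemma arg₁_lt {n : ℕ} (h : tagOf n ≠ 0) : arg₁ n < n :=
  (Nat.unpair_left_le _).trans_lt (argOf_lt h)
lemma arg₂_lt {n : ℕ} (h : tagOf n ≠ 0) : arg₂ n < n :=
  (Nat.unpair_right_le _).trans_lt (argOf_lt h)
lemma arg₂₁_le (n : ℕ) : (arg₂ n).unpair.1 ≤ n := (Nat.unpair_left_le _).trans (arg₂_le n)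
lemma arg₂₂_le (n : ℕ) : (arg₂ n).unpair.2 ≤ n := (Nat.unpair_right_le _).trans (arg₂_le n)

/-- A total decoding of numbers into rationals. -/
def ratOfCode (e : ℕ) : ℚ :=
  if tagOf e % 2 = 1 then -(((tagOf e / 2 + 1 : ℕ) : ℚ) / ((max (argOf e) 1 : ℕ) : ℚ))
  else ((tagOf e / 2 : ℕ) : ℚ) / ((argOf e : ℕ) : ℚ)

/-- A total decoding of numbers into intervals. -/
def intervalOfCode (e : ℕ) : RatInterval :=
  if tagOf e = 0 then .icc (ratOfCode (arg₁ e)) (ratOfCode (arg₂ e))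
  else if tagOf e = 1 then .ioc (ratOfCode (arg₁ e)) (ratOfCode (arg₂ e))
  else if tagOf e = 2 then .ico (ratOfCode (arg₁ e)) (ratOfCode (arg₂ e))
  else .ioo (ratOfCode (arg₁ e)) (ratOfCode (arg₂ e))

mutual
/-- A total decoding of numbers into state formulae. -/
def stateOfCode (n : ℕ) : SF ℕ :=
  if tagOf n = 1 then .atom (argOf n)
  else if _h2 : tagOf n = 2 then .and (stateOfCode (arg₁ n)) (stateOfCode (arg₂ n))
  else if _h3 : tagOf n = 3 then .or (stateOfCode (arg₁ n)) (stateOfCode (arg₂ n))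
  else if _h4 : tagOf n = 4 then .not (stateOfCode (argOf n))
  else if _h5 : tagOf n = 5 then .po (intervalOfCode (arg₁ n)) (pathOfCode (arg₂ n))
  else if _h6 : tagOf n = 6 then .ne (intervalOfCode (arg₁ n)) (pathOfCode (arg₂ n))
  else .tt
termination_by 2 * n
decreasing_by
  · have := arg₁_lt (n := n) (by omega); omega
  · have := arg₂_lt (n := n) (by omega); omega
  · have := arg₁_lt (n := n) (by omega); omega
  · have := arg₂_lt (n := n) (by omega); omega
  · have := argOf_lt (n := n) (by omega); omega
  · have := arg₂_lt (n := n) (by omega); omega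
  · have := arg₂_lt (n := n) (by omega); omega

/-- A total decoding of numbers into path formulae. -/
def pathOfCode (n : ℕ) : PF ℕ :=
  if tagOf n = 0 then .next (stateOfCode (argOf n))
  else if tagOf n = 1 then .untl (stateOfCode (arg₁ n)) (stateOfCode (arg₂ n))
  else if tagOf n = 2 then
    .buntl (arg₁ n) (stateOfCode (arg₂ n).unpair.1) (stateOfCode (arg₂ n).unpair.2)
  else if tagOf n = 3 then .rel (stateOfCode (arg₁ n)) (stateOfCode (arg₂ n))
  else if tagOf n = 4 then .ev (stateOfCode (argOf n))
  else .box (stateOfCode (argOf n))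
termination_by 2 * n + 1
decreasing_by
  · have := argOf_le n; omega
  · have := arg₁_le n; omega
  · have := arg₂_le n; omega
  · have := arg₂₁_le n; omega
  · have := arg₂₂_le n; omega
  · have := arg₁_le n; omega
  · have := arg₂_le n; omega
  · have := argOf_le n; omega
  · have := argOf_le n; omega
end

lemma ratOfCode_encode (q : ℚ) : ratOfCode (Encodable.encode q) = q := by
  have h : Encodable.encode q = Nat.pair (Encodable.encode q.num) q.den := rfl
  have hd : max q.den 1 = q.den := max_eq_left q.pos
  rw [h, ratOfCode]
  simp only [tagOf, argOf, Nat.unpair_pair, hd]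
  rcases hn : q.num with a | a
  · have : Encodable.encode (Int.ofNat a) = 2 * a := rfl
    rw [this, if_neg (by omega), Nat.mul_div_cancel_left _ (by norm_num)]
    conv_rhs => rw [← Rat.num_div_den q, hn]
    simp
  · have : Encodable.encode (Int.negSucc a) = 2 * a + 1 := rfl
    rw [this, if_pos (by omega), show (2 * a + 1) / 2 = a by omega]
    conv_rhs => rw [← Rat.num_div_den q, hn]
    push_cast [Int.negSucc_eq]
    ring

lemma intervalOfCode_code (J : RatInterval) : intervalOfCode J.code = J := by
  cases J <;>
    simp [intervalOfCode, RatInterval.code, tagOf, arg₁, arg₂, argOf, ratOfCode_encode]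

mutual
lemma stateOfCode_code : ∀ Φ : SF ℕ, stateOfCode Φ.code = Φ
  | .tt => by rw [stateOfCode]; simp [SF.code, tagOf]
  | .atom a => by rw [stateOfCode]; simp [SF.code, tagOf, argOf]
  | .and Φ Ψ => by
      rw [stateOfCode]
      simp [SF.code, tagOf, arg₁, arg₂, argOf, stateOfCode_code Φ, stateOfCode_code Ψ]
  | .or Φ Ψ => by
      rw [stateOfCode]
      simp [SF.code, tagOf, arg₁, arg₂, argOf, stateOfCode_code Φ, stateOfCode_code Ψ]
  | .not Φ => by
      rw [stateOfCode]
      simp [SF.code, tagOf, argOf, stateOfCode_code Φ]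
  | .po J φ => by
      rw [stateOfCode]
      simp [SF.code, tagOf, arg₁, arg₂, argOf, intervalOfCode_code, pathOfCode_code φ]
  | .ne J φ => by
      rw [stateOfCode]
      simp [SF.code, tagOf, arg₁, arg₂, argOf, intervalOfCode_code, pathOfCode_code φ]

lemma pathOfCode_code : ∀ φ : PF ℕ, pathOfCode φ.code = φ
  | .next Φ => by
      rw [pathOfCode]
      simp [PF.code, tagOf, argOf, stateOfCode_code Φ]
  | .untl Φ Ψ => by
      rw [pathOfCode]
      simp [PF.code, tagOf, arg₁, arg₂, argOf, stateOfCode_code Φ, stateOfCode_code Ψ]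
  | .buntl n Φ Ψ => by
      rw [pathOfCode]
      simp [PF.code, tagOf, arg₁, arg₂, argOf, stateOfCode_code Φ, stateOfCode_code Ψ]
  | .rel Φ Ψ => by
      rw [pathOfCode]
      simp [PF.code, tagOf, arg₁, arg₂, argOf, stateOfCode_code Φ, stateOfCode_code Ψ]
  | .ev Φ => by
      rw [pathOfCode]
      simp [PF.code, tagOf, argOf, stateOfCode_code Φ]
  | .box Φ => by
      rw [pathOfCode]
      simp [PF.code, tagOf, argOf, stateOfCode_code Φ]
end

mutual
/-- Replace the atoms of a state formula by their codes. -/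
def SF.encodeAtoms [Encodable A] : SF A → SF ℕ
  | .tt => .tt
  | .atom a => .atom (Encodable.encode a)
  | .and Φ Ψ => .and Φ.encodeAtoms Ψ.encodeAtoms
  | .or Φ Ψ => .or Φ.encodeAtoms Ψ.encodeAtoms
  | .not Φ => .not Φ.encodeAtoms
  | .po J φ => .po J φ.encodeAtoms
  | .ne J φ => .ne J φ.encodeAtoms

/-- Replace the atoms of a path formula by their codes. -/
def PF.encodeAtoms [Encodable A] : PF A → PF ℕ
  | .next Φ => .next Φ.encodeAtoms
  | .untl Φ Ψ => .untl Φ.encodeAtoms Ψ.encodeAtoms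
  | .buntl n Φ Ψ => .buntl n Φ.encodeAtoms Ψ.encodeAtoms
  | .rel Φ Ψ => .rel Φ.encodeAtoms Ψ.encodeAtoms
  | .ev Φ => .ev Φ.encodeAtoms
  | .box Φ => .box Φ.encodeAtoms
end

mutual
lemma SF.code_encodeAtoms [Encodable A] : ∀ Φ : SF A, Φ.encodeAtoms.code = Φ.code
  | .tt => rfl
  | .atom a => rfl
  | .and Φ Ψ => by
      simp only [SF.encodeAtoms, SF.code, SF.code_encodeAtoms Φ, SF.code_encodeAtoms Ψ]
  | .or Φ Ψ => by
      simp only [SF.encodeAtoms, SF.code, SF.code_encodeAtoms Φ, SF.code_encodeAtoms Ψ]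
  | .not Φ => by simp only [SF.encodeAtoms, SF.code, SF.code_encodeAtoms Φ]
  | .po J φ => by simp only [SF.encodeAtoms, SF.code, PF.code_encodeAtoms φ]
  | .ne J φ => by simp only [SF.encodeAtoms, SF.code, PF.code_encodeAtoms φ]

lemma PF.code_encodeAtoms [Encodable A] : ∀ φ : PF A, φ.encodeAtoms.code = φ.code
  | .next Φ => by simp only [PF.encodeAtoms, PF.code, SF.code_encodeAtoms Φ]
  | .untl Φ Ψ => by
      simp only [PF.encodeAtoms, PF.code, SF.code_encodeAtoms Φ, SF.code_encodeAtoms Ψ]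
  | .buntl n Φ Ψ => by
      simp only [PF.encodeAtoms, PF.code, SF.code_encodeAtoms Φ, SF.code_encodeAtoms Ψ]
  | .rel Φ Ψ => by
      simp only [PF.encodeAtoms, PF.code, SF.code_encodeAtoms Φ, SF.code_encodeAtoms Ψ]
  | .ev Φ => by simp only [PF.encodeAtoms, PF.code, SF.code_encodeAtoms Φ]
  | .box Φ => by simp only [PF.encodeAtoms, PF.code, SF.code_encodeAtoms Φ]
end

mutual
lemma SF.sat_encodeAtoms [Encodable A] (M : PKS S A) (N : PKS S ℕ) (hP : N.P = M.P)
    (hL : ∀ s a, Encodable.encode a ∈ N.L s ↔ a ∈ M.L s) :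
    ∀ (Φ : SF A) (s : S), Φ.encodeAtoms.Sat N s ↔ Φ.Sat M s
  | .tt, s => by simp only [SF.encodeAtoms, SF.Sat]
  | .atom a, s => by simp only [SF.encodeAtoms, SF.Sat, hL]
  | .and Φ Ψ, s => by
      simp only [SF.encodeAtoms, SF.Sat, SF.sat_encodeAtoms M N hP hL Φ,
        SF.sat_encodeAtoms M N hP hL Ψ]
  | .or Φ Ψ, s => by
      simp only [SF.encodeAtoms, SF.Sat, SF.sat_encodeAtoms M N hP hL Φ,
        SF.sat_encodeAtoms M N hP hL Ψ]
  | .not Φ, s => by simp only [SF.encodeAtoms, SF.Sat, SF.sat_encodeAtoms M N hP hL Φ]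
  | .po J φ, s => by
      simp only [SF.encodeAtoms, SF.Sat, PF.sat_encodeAtoms M N hP hL φ, PKS.IsPath,
        PKS.poPathFrom, hP]
  | .ne J φ, s => by
      simp only [SF.encodeAtoms, SF.Sat, PF.sat_encodeAtoms M N hP hL φ, PKS.IsPath,
        PKS.poPathFrom, hP]

lemma PF.sat_encodeAtoms [Encodable A] (M : PKS S A) (N : PKS S ℕ) (hP : N.P = M.P)
    (hL : ∀ s a, Encodable.encode a ∈ N.L s ↔ a ∈ M.L s) :
    ∀ (φ : PF A) (π : ℕ → S), φ.encodeAtoms.Sat N π ↔ φ.Sat M π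
  | .next Φ, π => by simp only [PF.encodeAtoms, PF.Sat, SF.sat_encodeAtoms M N hP hL Φ]
  | .untl Φ Ψ, π => by
      simp only [PF.encodeAtoms, PF.Sat, SF.sat_encodeAtoms M N hP hL Φ,
        SF.sat_encodeAtoms M N hP hL Ψ]
  | .buntl n Φ Ψ, π => by
      simp only [PF.encodeAtoms, PF.Sat, SF.sat_encodeAtoms M N hP hL Φ,
        SF.sat_encodeAtoms M N hP hL Ψ]
  | .rel Φ Ψ, π => by
      simp only [PF.encodeAtoms, PF.Sat, SF.sat_encodeAtoms M N hP hL Φ,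
        SF.sat_encodeAtoms M N hP hL Ψ]
  | .ev Φ, π => by simp only [PF.encodeAtoms, PF.Sat, SF.sat_encodeAtoms M N hP hL Φ]
  | .box Φ, π => by simp only [PF.encodeAtoms, PF.Sat, SF.sat_encodeAtoms M N hP hL Φ]
end

/-- Satisfiability is invariant under replacing atoms by their codes. -/
lemma satisfiable_encodeAtoms [Encodable A] (Φ : SF A) :
    SFSatisfiable Φ.encodeAtoms ↔ SFSatisfiable Φ := by
  constructor
  · rintro ⟨S, N, s, h⟩
    let M : PKS S A := { N with L := fun s => {a | Encodable.encode a ∈ N.L s} }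
    exact ⟨S, M, s, (SF.sat_encodeAtoms M N rfl (fun _ _ => Iff.rfl) Φ s).1 h⟩
  · rintro ⟨S, M, s, h⟩
    let N : PKS S ℕ := { M with L := fun s => Encodable.encode '' M.L s }
    refine ⟨S, N, s, (SF.sat_encodeAtoms M N rfl (fun s a => ?_) Φ s).2 h⟩
    exact Encodable.encode_injective.mem_set_image

/-! ### Path items and their fixpoint unfolding

An item `5 * p + i` stands for the path formula with code `p` (`i = 0`), for its negation
(`i = 1`), for the state formula with code `p` holding now (`i = 2`) or failing now (`i = 3`);
the item `4` holds on every path. -/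

/-- The kind of an item. -/
def kindOf (φ : ℕ) : ℕ := φ % 5
/-- The formula code of an item. -/
def bodyOf (φ : ℕ) : ℕ := φ / 5

/-- The path formula with code `p` is fulfilled by the present state alone. -/
def pathNow (T : ℕ → Prop) (p : ℕ) : Prop :=
  (tagOf p = 1 ∧ T (arg₂ p)) ∨ (tagOf p = 2 ∧ T (arg₂ p).unpair.2) ∨
    (tagOf p = 3 ∧ T (arg₁ p) ∧ T (arg₂ p)) ∨ (tagOf p = 4 ∧ T (argOf p))

/-- The path formula with code `p` can be postponed at the present state. -/
def pathCont (T : ℕ → Prop) (p : ℕ) : Prop :=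
  tagOf p = 0 ∨ (tagOf p = 1 ∧ T (arg₁ p)) ∨
    (tagOf p = 2 ∧ arg₁ p ≠ 0 ∧ T (arg₂ p).unpair.1) ∨ (tagOf p = 3 ∧ T (arg₂ p)) ∨
    tagOf p = 4 ∨ (5 ≤ tagOf p ∧ T (argOf p))

/-- The negated path formula with code `p` is fulfilled by the present state alone. -/
def negNow (T : ℕ → Prop) (p : ℕ) : Prop :=
  (tagOf p = 1 ∧ ¬T (arg₁ p) ∧ ¬T (arg₂ p)) ∨
    (tagOf p = 2 ∧ ¬T (arg₂ p).unpair.2 ∧ (arg₁ p = 0 ∨ ¬T (arg₂ p).unpair.1)) ∨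
    (tagOf p = 3 ∧ ¬T (arg₂ p)) ∨ (5 ≤ tagOf p ∧ ¬T (argOf p))

/-- The negated path formula with code `p` can be postponed at the present state. -/
def negCont (T : ℕ → Prop) (p : ℕ) : Prop :=
  tagOf p = 0 ∨ (tagOf p = 1 ∧ ¬T (arg₂ p)) ∨
    (tagOf p = 2 ∧ arg₁ p ≠ 0 ∧ ¬T (arg₂ p).unpair.2) ∨ (tagOf p = 3 ∧ ¬T (arg₁ p)) ∨
    (tagOf p = 4 ∧ ¬T (argOf p)) ∨ 5 ≤ tagOf p

/-- The item is fulfilled by the present state alone. -/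
def itemNow (T : ℕ → Prop) (φ : ℕ) : Prop :=
  (kindOf φ = 0 ∧ pathNow T (bodyOf φ)) ∨ (kindOf φ = 1 ∧ negNow T (bodyOf φ)) ∨
    (kindOf φ = 2 ∧ T (bodyOf φ)) ∨ (kindOf φ = 3 ∧ ¬T (bodyOf φ))

/-- The item can be postponed at the present state. -/
def itemCont (T : ℕ → Prop) (φ : ℕ) : Prop :=
  (kindOf φ = 0 ∧ pathCont T (bodyOf φ)) ∨ (kindOf φ = 1 ∧ negCont T (bodyOf φ)) ∨
    kindOf φ = 4

/-- The item remaining after one step when an item is postponed. -/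
def itemNext (φ : ℕ) : ℕ :=
  if kindOf φ < 2 ∧ tagOf (bodyOf φ) = 0 then 5 * argOf (bodyOf φ) + kindOf φ + 2
  else if kindOf φ < 2 ∧ tagOf (bodyOf φ) = 2 ∧ arg₁ (bodyOf φ) ≠ 0 then
    5 * Nat.pair 2 (Nat.pair (arg₁ (bodyOf φ) - 1) (arg₂ (bodyOf φ))) + kindOf φ
  else φ

/-- The item may be postponed forever. -/
def itemInf (φ : ℕ) : Prop :=
  (kindOf φ = 0 ∧ (tagOf (bodyOf φ) = 3 ∨ 5 ≤ tagOf (bodyOf φ))) ∨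
    (kindOf φ = 1 ∧ (tagOf (bodyOf φ) = 1 ∨ tagOf (bodyOf φ) = 4)) ∨ kindOf φ = 4

/-- Fulfilment of an item along a sequence of truth assignments. -/
def psat (T : ℕ → ℕ → Prop) (φ : ℕ) : Prop :=
  (∃ j, itemNow (T j) (itemNext^[j] φ) ∧ ∀ i < j, itemCont (T i) (itemNext^[i] φ)) ∨
    (itemInf φ ∧ ∀ j, itemCont (T j) (itemNext^[j] φ))

lemma kindOf_add {p i : ℕ} (h : i < 5) : kindOf (5 * p + i) = i := by
  unfold kindOf; omega

lemma bodyOf_add {p i : ℕ} (h : i < 5) : bodyOf (5 * p + i) = p := by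
  unfold bodyOf; omega

lemma kindOf_lt (φ : ℕ) : kindOf φ < 5 := Nat.mod_lt _ (by norm_num)

lemma item_eq (φ : ℕ) : 5 * bodyOf φ + kindOf φ = φ := Nat.div_add_mod φ 5

lemma pair_tag_two {p : ℕ} (h : tagOf p = 2) : Nat.pair 2 (Nat.pair (arg₁ p) (arg₂ p)) = p := by
  rw [arg₁, arg₂, Nat.pair_unpair, ← h, tagOf, argOf, Nat.pair_unpair]

lemma boundedStep_lt {p : ℕ} (h : tagOf p = 2) (h0 : arg₁ p ≠ 0) :
    Nat.pair 2 (Nat.pair (arg₁ p - 1) (arg₂ p)) < p := by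
  conv_rhs => rw [← pair_tag_two h]
  exact Nat.pair_lt_pair_right _ (Nat.pair_lt_pair_left _ (by omega))

lemma bodyOf_itemNext_le (φ : ℕ) : bodyOf (itemNext φ) ≤ bodyOf φ := by
  unfold itemNext
  split_ifs with h h'
  · have := argOf_le (bodyOf φ)
    rw [show ∀ a b, 5 * a + b + 2 = 5 * a + (b + 2) from fun _ _ => rfl, bodyOf_add (by omega)]
    exact this
  · rw [bodyOf_add (by omega)]
    exact (boundedStep_lt h'.2.1 h'.2.2).le
  · exact le_rfl

lemma item_lt_iff {φ C : ℕ} : φ < 5 * C ↔ bodyOf φ < C := by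
  have := item_eq φ
  have := kindOf_lt φ
  omega

lemma itemNext_lt {φ C : ℕ} (h : φ < 5 * C) : itemNext φ < 5 * C := by
  rw [item_lt_iff] at *
  exact (bodyOf_itemNext_le φ).trans_lt h

/-- Every item other than a fixpoint either becomes a statement about the present or has
a smaller body. -/
lemma itemNext_cases (φ : ℕ) : itemNext φ = φ ∨ itemNext (itemNext φ) = itemNext φ ∨
    bodyOf (itemNext φ) < bodyOf φ := by
  by_cases h : kindOf φ < 2 ∧ tagOf (bodyOf φ) = 0
  · right; left
    have h1 : itemNext φ = 5 * argOf (bodyOf φ) + (kindOf φ + 2) := by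
      unfold itemNext; rw [if_pos h]; ring
    have h2 : ¬ kindOf (itemNext φ) < 2 := by rw [h1, kindOf_add (by omega)]; omega
    generalize itemNext φ = χ at *
    unfold itemNext
    rw [if_neg (fun h => h2 h.1), if_neg (fun h => h2 h.1)]
  · by_cases h' : kindOf φ < 2 ∧ tagOf (bodyOf φ) = 2 ∧ arg₁ (bodyOf φ) ≠ 0
    · right; right
      unfold itemNext
      rw [if_neg h, if_pos h', bodyOf_add (by omega)]
      exact boundedStep_lt h'.2.1 h'.2.2
    · left
      unfold itemNext
      rw [if_neg h, if_neg h']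

lemma exists_iterate_fixed (φ : ℕ) : ∃ j, itemNext (itemNext^[j] φ) = itemNext^[j] φ := by
  suffices ∀ n φ, bodyOf φ < n → ∃ j, itemNext (itemNext^[j] φ) = itemNext^[j] φ from
    this _ φ (Nat.lt_succ_self _)
  intro n
  induction n with
  | zero => intro φ h; omega
  | succ n ih =>
    intro φ h
    rcases itemNext_cases φ with h1 | h1 | h1
    · exact ⟨0, h1⟩
    · exact ⟨1, h1⟩
    · obtain ⟨j, hj⟩ := ih (itemNext φ) (by omega)
      exact ⟨j + 1, by simpa using hj⟩

lemma iterate_eq_of_fixed {φ j i : ℕ} (h : itemNext (itemNext^[j] φ) = itemNext^[j] φ)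
    (hi : j ≤ i) : itemNext^[i] φ = itemNext^[j] φ := by
  obtain ⟨d, rfl⟩ := Nat.exists_eq_add_of_le hi
  rw [add_comm, Function.iterate_add_apply]
  exact Function.iterate_fixed h d

lemma itemInf_itemNext (φ : ℕ) : itemInf (itemNext φ) ↔ itemInf φ := by
  by_cases h : kindOf φ < 2 ∧ tagOf (bodyOf φ) = 0
  · have h1 : itemNext φ = 5 * argOf (bodyOf φ) + (kindOf φ + 2) := by
      unfold itemNext; rw [if_pos h]; ring
    unfold itemInf
    rw [h1, kindOf_add (by omega)]
    omega
  · by_cases h' : kindOf φ < 2 ∧ tagOf (bodyOf φ) = 2 ∧ arg₁ (bodyOf φ) ≠ 0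
    · unfold itemNext
      rw [if_neg h, if_pos h']
      unfold itemInf
      rw [kindOf_add (by omega), bodyOf_add (by omega), h'.2.1]
      simp only [tagOf, Nat.unpair_pair]
    · unfold itemNext
      rw [if_neg h, if_neg h']

lemma itemInf_iterate (φ j : ℕ) : itemInf (itemNext^[j] φ) ↔ itemInf φ := by
  induction j with
  | zero => rfl
  | succ j ih => rw [Function.iterate_succ_apply', itemInf_itemNext, ih]

lemma pathNow_congr {T T' : ℕ → Prop} {p : ℕ} (h : ∀ a ≤ p, T a ↔ T' a) :
    pathNow T p ↔ pathNow T' p := by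
  simp only [pathNow, h _ (arg₁_le p), h _ (arg₂_le p), h _ (argOf_le p), h _ (arg₂₂_le p)]

lemma pathCont_congr {T T' : ℕ → Prop} {p : ℕ} (h : ∀ a ≤ p, T a ↔ T' a) :
    pathCont T p ↔ pathCont T' p := by
  simp only [pathCont, h _ (arg₁_le p), h _ (arg₂_le p), h _ (argOf_le p), h _ (arg₂₁_le p)]

lemma negNow_congr {T T' : ℕ → Prop} {p : ℕ} (h : ∀ a ≤ p, T a ↔ T' a) :
    negNow T p ↔ negNow T' p := by
  simp only [negNow, h _ (arg₁_le p), h _ (arg₂_le p), h _ (argOf_le p), h _ (arg₂₁_le p),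
    h _ (arg₂₂_le p)]

lemma negCont_congr {T T' : ℕ → Prop} {p : ℕ} (h : ∀ a ≤ p, T a ↔ T' a) :
    negCont T p ↔ negCont T' p := by
  simp only [negCont, h _ (arg₁_le p), h _ (arg₂_le p), h _ (argOf_le p), h _ (arg₂₂_le p)]

lemma itemNow_congr {T T' : ℕ → Prop} {φ : ℕ} (h : ∀ a ≤ bodyOf φ, T a ↔ T' a) :
    itemNow T φ ↔ itemNow T' φ := by
  simp only [itemNow, pathNow_congr h, negNow_congr h, h _ le_rfl]

lemma itemCont_congr {T T' : ℕ → Prop} {φ : ℕ} (h : ∀ a ≤ bodyOf φ, T a ↔ T' a) :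
    itemCont T φ ↔ itemCont T' φ := by
  simp only [itemCont, pathCont_congr h, negCont_congr h]

lemma bodyOf_iterate_le (φ j : ℕ) : bodyOf (itemNext^[j] φ) ≤ bodyOf φ := by
  induction j with
  | zero => rfl
  | succ j ih => rw [Function.iterate_succ_apply']; exact (bodyOf_itemNext_le _).trans ih

lemma psat_congr {T T' : ℕ → ℕ → Prop} {φ : ℕ} (h : ∀ j, ∀ a ≤ bodyOf φ, T j a ↔ T' j a) :
    psat T φ ↔ psat T' φ := by
  have h1 : ∀ j i, itemNow (T j) (itemNext^[i] φ) ↔ itemNow (T' j) (itemNext^[i] φ) :=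
    fun j i => itemNow_congr fun a ha => h j a (ha.trans (bodyOf_iterate_le φ i))
  have h2 : ∀ j i, itemCont (T j) (itemNext^[i] φ) ↔ itemCont (T' j) (itemNext^[i] φ) :=
    fun j i => itemCont_congr fun a ha => h j a (ha.trans (bodyOf_iterate_le φ i))
  simp only [psat, h1, h2]

/-- The fixpoint unfolding of items. -/
lemma psat_unfold (T : ℕ → ℕ → Prop) (φ : ℕ) :
    psat T φ ↔ itemNow (T 0) φ ∨ (itemCont (T 0) φ ∧ psat (fun j => T (j + 1)) (itemNext φ)) := by
  constructor
  · rintro (⟨j, h1, h2⟩ | ⟨h1, h2⟩)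
    · rcases j with _ | j
      · exact Or.inl h1
      · refine Or.inr ⟨h2 0 (by omega), Or.inl ⟨j, h1, fun i hi => ?_⟩⟩
        exact h2 (i + 1) (by omega)
    · exact Or.inr ⟨h2 0, Or.inr ⟨(itemInf_itemNext φ).2 h1, fun j => h2 (j + 1)⟩⟩
  · rintro (h | ⟨h, ⟨j, h1, h2⟩ | ⟨h1, h2⟩⟩)
    · exact Or.inl ⟨0, h, fun i hi => by omega⟩
    · refine Or.inl ⟨j + 1, h1, fun i hi => ?_⟩
      rcases i with _ | i
      · exact h
      · exact h2 i (by omega)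
    · refine Or.inr ⟨(itemInf_itemNext φ).1 h1, fun j => ?_⟩
      rcases j with _ | j
      · exact h
      · exact h2 j

lemma psat_true (T : ℕ → ℕ → Prop) : psat T 4 := by
  have h : itemNext 4 = 4 := by simp [itemNext, kindOf]
  refine Or.inr ⟨by simp [itemInf, kindOf], fun j => ?_⟩
  rw [Function.iterate_fixed h]
  simp [itemCont, kindOf]

lemma itemNow_true (T : ℕ → Prop) : ¬ itemNow T 4 := by
  simp [itemNow, kindOf]

lemma tagOf_pair (t a : ℕ) : tagOf (Nat.pair t a) = t := by simp [tagOf]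

lemma arg₁_pair (t a b : ℕ) : arg₁ (Nat.pair t (Nat.pair a b)) = a := by simp [arg₁, argOf]

lemma arg₂_pair (t a b : ℕ) : arg₂ (Nat.pair t (Nat.pair a b)) = b := by simp [arg₂, argOf]

lemma psat_of_fixed {φ : ℕ} (h : itemNext φ = φ) (T : ℕ → ℕ → Prop) :
    psat T φ ↔ (∃ j, itemNow (T j) φ ∧ ∀ i < j, itemCont (T i) φ) ∨
      (itemInf φ ∧ ∀ j, itemCont (T j) φ) := by
  simp only [psat, Function.iterate_fixed h]

lemma not_until_iff (A B : ℕ → Prop) :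
    (¬ ∃ k, B k ∧ ∀ i < k, A i) ↔
      (∃ j, (¬A j ∧ ¬B j) ∧ ∀ i < j, ¬B i) ∨ ∀ j, ¬B j := by
  classical
  constructor
  · intro h
    by_cases hB : ∃ j, B j
    · left
      have hA : ∃ i < Nat.find hB, ¬A i := by
        by_contra! hA
        exact h ⟨_, Nat.find_spec hB, hA⟩
      obtain ⟨i, hi, hAi⟩ := hA
      exact ⟨i, ⟨hAi, Nat.find_min hB hi⟩, fun j hj => Nat.find_min hB (hj.trans hi)⟩
    · right
      exact not_exists.1 hB
  · rintro (⟨j, ⟨h1, h2⟩, h3⟩ | h) ⟨k, hk, hA⟩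
    · rcases lt_trichotomy k j with hkj | rfl | hkj
      · exact h3 k hkj hk
      · exact h2 hk
      · exact h1 (hA j hkj)
    · exact h k hk

lemma release_iff (A B : ℕ → Prop) :
    (∀ j, ¬B j → ∃ k < j, A k) ↔
      (∃ j, (A j ∧ B j) ∧ ∀ i < j, B i) ∨ ∀ j, B j := by
  have h := not_until_iff (fun j => ¬A j) (fun j => ¬B j)
  simp only [not_not] at h
  rw [← h]
  push Not
  rfl

section

variable {T : ℕ → ℕ → Prop} {p : ℕ}

lemma itemNext_fixed {i : ℕ} (hi : i < 2) (h0 : tagOf p ≠ 0)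
    (h2 : tagOf p = 2 → arg₁ p = 0) : itemNext (5 * p + i) = 5 * p + i := by
  unfold itemNext
  rw [kindOf_add (by omega), bodyOf_add (by omega), if_neg (by tauto), if_neg (by tauto)]

lemma itemNext_next {i : ℕ} (hi : i < 2) (h0 : tagOf p = 0) :
    itemNext (5 * p + i) = 5 * argOf p + (i + 2) := by
  unfold itemNext
  rw [kindOf_add (by omega), bodyOf_add (by omega), if_pos ⟨hi, h0⟩]
  ring

lemma itemNext_bounded {i : ℕ} (hi : i < 2) (h2 : tagOf p = 2) (h1 : arg₁ p ≠ 0) :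
    itemNext (5 * p + i) = 5 * Nat.pair 2 (Nat.pair (arg₁ p - 1) (arg₂ p)) + i := by
  unfold itemNext
  rw [kindOf_add (by omega), bodyOf_add (by omega), if_neg (by omega), if_pos ⟨hi, h2, h1⟩]

lemma itemNow_zero (t : ℕ → Prop) : itemNow t (5 * p + 0) ↔ pathNow t p := by
  unfold itemNow
  rw [kindOf_add (by omega), bodyOf_add (by omega)]
  simp

lemma itemNow_one (t : ℕ → Prop) : itemNow t (5 * p + 1) ↔ negNow t p := by
  unfold itemNow
  rw [kindOf_add (by omega), bodyOf_add (by omega)]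
  simp

lemma itemCont_zero (t : ℕ → Prop) : itemCont t (5 * p + 0) ↔ pathCont t p := by
  unfold itemCont
  rw [kindOf_add (by omega), bodyOf_add (by omega)]
  simp

lemma itemCont_one (t : ℕ → Prop) : itemCont t (5 * p + 1) ↔ negCont t p := by
  unfold itemCont
  rw [kindOf_add (by omega), bodyOf_add (by omega)]
  simp

lemma itemInf_zero : itemInf (5 * p + 0) ↔ (tagOf p = 3 ∨ 5 ≤ tagOf p) := by
  unfold itemInf
  rw [kindOf_add (by omega), bodyOf_add (by omega)]
  simp

lemma itemInf_one : itemInf (5 * p + 1) ↔ (tagOf p = 1 ∨ tagOf p = 4) := by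
  unfold itemInf
  rw [kindOf_add (by omega), bodyOf_add (by omega)]
  simp

lemma psat_state : psat T (5 * p + 2) ↔ T 0 p := by
  rw [psat_unfold]
  unfold itemNow itemCont
  rw [kindOf_add (by omega), bodyOf_add (by omega)]
  simp

lemma psat_not_state : psat T (5 * p + 3) ↔ ¬T 0 p := by
  rw [psat_unfold]
  unfold itemNow itemCont
  rw [kindOf_add (by omega), bodyOf_add (by omega)]
  simp

lemma psat_bounded (h : tagOf p = 2) : psat T (5 * p + 0) ↔
    ∃ k ≤ arg₁ p, T k (arg₂ p).unpair.2 ∧ ∀ i < k, T i (arg₂ p).unpair.1 := by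
  induction hn : arg₁ p generalizing T p with
  | zero =>
    rw [psat_unfold, itemNow_zero, itemCont_zero]
    simp [pathNow, pathCont, h, hn]
  | succ n ih =>
    have h1 : arg₁ p ≠ 0 := by omega
    rw [psat_unfold, itemNext_bounded (by omega) h h1,
      ih (tagOf_pair _ _) (by rw [arg₁_pair, hn]; rfl), arg₂_pair, itemNow_zero, itemCont_zero]
    simp only [pathNow, pathCont, h, hn]
    constructor
    · rintro (h | ⟨h, k, hk, h3, h4⟩)
      · exact ⟨0, by omega, by simpa using h, by omega⟩
      · refine ⟨k + 1, by omega, h3, fun i hi => ?_⟩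
        rcases i with _ | i
        · simpa using h
        · exact h4 i (by omega)
    · rintro ⟨k, hk, h3, h4⟩
      rcases k with _ | k
      · left; simpa using h3
      · right
        exact ⟨by simpa using h4 0 (by omega), k, by omega, h3,
          fun i hi => h4 (i + 1) (by omega)⟩

lemma psat_not_bounded (h : tagOf p = 2) : psat T (5 * p + 1) ↔
    ¬ ∃ k ≤ arg₁ p, T k (arg₂ p).unpair.2 ∧ ∀ i < k, T i (arg₂ p).unpair.1 := by
  induction hn : arg₁ p generalizing T p with
  | zero =>
    rw [psat_unfold, itemNow_one, itemCont_one]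
    simp [negNow, negCont, h, hn]
  | succ n ih =>
    have h1 : arg₁ p ≠ 0 := by omega
    rw [psat_unfold, itemNext_bounded (by omega) h h1,
      ih (tagOf_pair _ _) (by rw [arg₁_pair, hn]; rfl), arg₂_pair, itemNow_one, itemCont_one]
    simp only [negNow, negCont, h, hn]
    constructor
    · rintro (h | ⟨h, h'⟩) ⟨k, hk, h3, h4⟩
      · rcases k with _ | k
        · simp_all
        · have := h4 0 (by omega)
          simp_all
      · rcases k with _ | k
        · simp_all
        · exact h' ⟨k, by omega, h3, fun i hi => h4 (i + 1) (by omega)⟩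
    · intro h
      have hb : ¬T 0 (arg₂ p).unpair.2 := fun hb =>
        h ⟨0, by omega, hb, by omega⟩
      by_cases ha : T 0 (arg₂ p).unpair.1
      · right
        refine ⟨by simpa using hb, ?_⟩
        rintro ⟨k, hk, h3, h4⟩
        refine h ⟨k + 1, by omega, h3, fun i hi => ?_⟩
        rcases i with _ | i
        · exact ha
        · exact h4 i (by omega)
      · left
        simp [ha, hb]

variable (M : PKS S ℕ) (π : ℕ → S)

/-- Items of kind `0` and `1` express the path formula and its negation. -/
lemma psat_path (hT : ∀ j a, T j a ↔ (stateOfCode a).Sat M (π j)) :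
    (psat T (5 * p + 0) ↔ (pathOfCode p).Sat M π) ∧
      (psat T (5 * p + 1) ↔ ¬(pathOfCode p).Sat M π) := by
  rw [pathOfCode]
  split_ifs with h0 h1 h2 h3 h4
  · simp only [PF.Sat, ← hT]
    constructor
    · rw [psat_unfold, itemNext_next (by omega) h0, psat_state, itemNow_zero, itemCont_zero]
      simp [pathNow, pathCont, h0]
    · rw [psat_unfold, itemNext_next (by omega) h0, psat_not_state, itemNow_one, itemCont_one]
      simp [negNow, negCont, h0]
  · simp only [PF.Sat, ← hT]
    rw [psat_of_fixed (itemNext_fixed (by omega) h0 (by omega)),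
      psat_of_fixed (itemNext_fixed (by omega) h0 (by omega)), itemInf_zero, itemInf_one]
    simp only [itemNow_zero, itemNow_one, itemCont_zero, itemCont_one, not_until_iff]
    simp [pathNow, pathCont, negNow, negCont, h1]
  · simp only [PF.Sat, ← hT]
    exact ⟨psat_bounded h2, psat_not_bounded h2⟩
  · simp only [PF.Sat, ← hT]
    rw [psat_of_fixed (itemNext_fixed (by omega) h0 (by omega)),
      psat_of_fixed (itemNext_fixed (by omega) h0 (by omega)), itemInf_zero, itemInf_one]
    simp only [itemNow_zero, itemNow_one, itemCont_zero, itemCont_one]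
    constructor
    · rw [release_iff]
      simp [pathNow, pathCont, h3]
    · simp [negNow, negCont, h3]
  · simp only [PF.Sat, ← hT]
    rw [psat_of_fixed (itemNext_fixed (by omega) h0 (by omega)),
      psat_of_fixed (itemNext_fixed (by omega) h0 (by omega)), itemInf_zero, itemInf_one]
    simp only [itemNow_zero, itemNow_one, itemCont_zero, itemCont_one]
    simp [pathNow, pathCont, negNow, negCont, h4]
  · simp only [PF.Sat, ← hT]
    have h5 : 5 ≤ tagOf p := by omega
    rw [psat_of_fixed (itemNext_fixed (by omega) h0 (by omega)),
      psat_of_fixed (itemNext_fixed (by omega) h0 (by omega)), itemInf_zero, itemInf_one]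
    simp only [itemNow_zero, itemNow_one, itemCont_zero, itemCont_one]
    constructor
    · simp [pathNow, pathCont, h0, h1, h2, h3, h4, h5]
    · simp only [negNow, negCont, h0, h1, h2, h3, h4, h5, false_and, false_or, true_and,
        or_true, implies_true, and_true, or_false, not_forall]

end

/-! ### Certificates of satisfiability

Fix a bound `c` on formula codes. Possibilities are compared with the grid of multiples of
`1 / gridOf c`; the open intervals between consecutive grid points are the *regions*. A *node*
records a region containing a threshold `y`, the state formulae true at a state, and for every
item a comparison of its possibility at the state with `y` and with the grid points. -/

/-- The number of regions. -/
def gridOf (c : ℕ) : ℕ := (c + 1).factorial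

/-- Binary digits as a membership relation. -/
def bitOf (x i : ℕ) : Prop := x / 2 ^ i % 2 = 1

/-- The region of a node. -/
def rg (n : ℕ) : ℕ := n.unpair.1
/-- The state formula with code `a` is true at the node. -/
def tr (n a : ℕ) : Prop := bitOf n.unpair.2 (4 * a)
/-- The possibility of the item `φ` is above the threshold of the node. -/
def bs (n φ : ℕ) : Prop := bitOf n.unpair.2 (4 * φ + 1)
/-- The possibility of the item `φ` is above the lower end of region `k`. -/
def gs (n k φ : ℕ) : Prop := bitOf n.unpair.2 (4 * Nat.pair k φ + 2)
/-- The possibility of the item `φ` is at least the upper end of region `k`. -/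
def es (n k φ : ℕ) : Prop := bitOf n.unpair.2 (4 * Nat.pair k φ + 3)

/-- A bound on the digits used in nodes. -/
def nodeWidth (c : ℕ) : ℕ := 4 * Nat.pair (gridOf c) (5 * (c + 1))
/-- A bound on nodes. -/
def nodeBound (c : ℕ) : ℕ := Nat.pair (gridOf c) (2 ^ nodeWidth c)

/-- The numerator over `gridOf c` of a nonnegative rational code. -/
def gridIdx (c e : ℕ) : ℕ := tagOf e / 2 * (gridOf c / argOf e)

/-- The possibility of `φ` is at least the rational with code `e`. -/
def geP (c n φ e : ℕ) : Prop :=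
  tagOf e % 2 = 1 ∨ gridIdx c e = 0 ∨ (gridIdx c e ≤ gridOf c ∧ es n (gridIdx c e - 1) φ)
/-- The possibility of `φ` is greater than the rational with code `e`. -/
def gtP (c n φ e : ℕ) : Prop :=
  tagOf e % 2 = 1 ∨ (gridIdx c e < gridOf c ∧ gs n (gridIdx c e) φ)
/-- One minus the possibility of `φ` is at least the rational with code `e`. -/
def geN (c n φ e : ℕ) : Prop :=
  tagOf e % 2 = 1 ∨ gridIdx c e = 0 ∨
    (gridIdx c e ≤ gridOf c ∧ ¬gs n (gridOf c - gridIdx c e) φ)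
/-- One minus the possibility of `φ` is greater than the rational with code `e`. -/
def gtN (c n φ e : ℕ) : Prop :=
  tagOf e % 2 = 1 ∨ (gridIdx c e < gridOf c ∧ ¬es n (gridOf c - gridIdx c e - 1) φ)

/-- Membership in the interval with code `J`, expressed by comparisons. -/
def inInterval (ge gt : ℕ → Prop) (J : ℕ) : Prop :=
  (((tagOf J = 0 ∨ tagOf J = 2) ∧ ge (arg₁ J)) ∨
    (¬(tagOf J = 0 ∨ tagOf J = 2) ∧ gt (arg₁ J))) ∧
  ((tagOf J < 2 ∧ ¬gt (arg₂ J)) ∨ (¬tagOf J < 2 ∧ ¬ge (arg₂ J)))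

/-- Local correctness of the truth value of the state formula with code `a`. -/
def truthClause (c n a : ℕ) : Prop :=
  (tagOf a = 2 → (tr n a ↔ (tr n (arg₁ a) ∧ tr n (arg₂ a)))) ∧
  (tagOf a = 3 → (tr n a ↔ (tr n (arg₁ a) ∨ tr n (arg₂ a)))) ∧
  (tagOf a = 4 → (tr n a ↔ ¬tr n (argOf a))) ∧
  (tagOf a = 5 → (tr n a ↔
    inInterval (geP c n (5 * arg₂ a + 0)) (gtP c n (5 * arg₂ a + 0)) (arg₁ a))) ∧
  (tagOf a = 6 → (tr n a ↔
    inInterval (geN c n (5 * arg₂ a + 1)) (gtN c n (5 * arg₂ a + 1)) (arg₁ a))) ∧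
  (tagOf a = 0 ∨ 7 ≤ tagOf a → tr n a)

/-- The node claims a value of `φ` above the lower end of region `k` (`r = 0`), at least the
upper end (`r = 1`), or above its own threshold in region `k` (`r = 2`). -/
def want (n r k φ : ℕ) : Prop :=
  (r = 0 ∧ gs n k φ) ∨ (r = 1 ∧ es n k φ) ∨ (r = 2 ∧ rg n = k ∧ bs n φ)

/-- A claim of a node which has to be witnessed by a successor. -/
def demand (c n r k φ : ℕ) : Prop :=
  r < 3 ∧ k < gridOf c ∧ φ < 5 * (c + 1) ∧ want n r k φ ∧ ¬itemNow (tr n) φ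

/-- `n'` may be a successor of `n` with a transition possibility at the threshold of `n'`. -/
def edge (c R n r k n' : ℕ) : Prop :=
  bitOf R n' ∧ rg n' = k ∧ ∀ χ < 5 * (c + 1), itemCont (tr n) χ →
    (bs n' (itemNext χ) → want n r k χ) ∧
    (∀ j < k, es n' j (itemNext χ) → es n j χ) ∧
    ∀ j < k + 1, gs n' j (itemNext χ) → gs n j χ

/-- `n'` witnesses a demand of `n`. -/
def child (c R n r k φ n' : ℕ) : Prop :=
  edge c R n r k n' ∧ itemCont (tr n) φ ∧ bs n' (itemNext φ)

/-- Edges of this type have possibility arbitrarily close to the upper end of region `k`, or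
staying above the threshold. -/
def live (k r k' : ℕ) : Prop := k < k' ∨ (k' = k ∧ r ≠ 0)

/-- The value of `ψ` is claimed to be high relative to region `k`. -/
def cut (k n ψ : ℕ) : Prop := (rg n = k ∧ bs n ψ) ∨ (rg n ≠ k ∧ es n k ψ)

/-- Local consistency of a node. -/
def localOK (c n : ℕ) : Prop :=
  rg n < gridOf c ∧ (∀ a < c + 1, truthClause c n a) ∧ es n (gridOf c - 1) 4 ∧
  ∀ k < gridOf c, ∀ φ < 5 * (c + 1),
    (itemNow (tr n) φ → es n k φ) ∧ (es n k φ → gs n k φ) ∧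
    (rg n = k → (es n k φ → bs n φ) ∧ (bs n φ → gs n k φ))

/-- Some node witnesses a demand of `n`. -/
def witnessed (c R n r k φ : ℕ) : Prop := ∃ n' < nodeBound c, child c R n r k φ n'

/-- Every demand is witnessed. -/
def demandsOK (c R n : ℕ) : Prop :=
  ∀ r < 3, ∀ k < gridOf c, ∀ φ < 5 * (c + 1), demand c n r k φ → witnessed c R n r k φ

/-- `Z` is closed under witnesses while never fulfilling the item `φ`. -/
def euClosed (c R φ Z : ℕ) : Prop :=
  ∀ m < nodeBound c, bitOf Z m → bitOf R m ∧ ¬itemNow (tr m) φ ∧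
    ∀ n' < nodeBound c, edge c R m 2 (rg m) n' → bs n' φ → bitOf Z n'

/-- Claims for items which must be fulfilled eventually are not postponed forever. -/
def euOK (c R : ℕ) : Prop :=
  ∀ φ < 5 * (c + 1), itemNext φ = φ → ¬itemInf φ → ∀ Z < 2 ^ nodeBound c,
    euClosed c R φ Z → ∀ n < nodeBound c, bitOf Z n → ¬bs n φ

/-- All witnesses of a demand of `m` are in `Z`. -/
def trapped (c R m r k φ Z : ℕ) : Prop := ∀ n' < nodeBound c, child c R m r k φ n' → bitOf Z n'

/-- Some live demand of `m` has all its witnesses in `Z`. -/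
def liveTrapped (c R k Z m : ℕ) : Prop :=
  ∃ r < 3, ∃ k' < gridOf c, ∃ φ < 5 * (c + 1),
    live k r k' ∧ demand c m r k' φ ∧ trapped c R m r k' φ Z

/-- In `Z` the item `ψ` can be postponed while some live demand forces to stay in `Z`. -/
def afClosed (c R k ψ Z : ℕ) : Prop :=
  ∀ m < nodeBound c, bitOf Z m → bitOf R m ∧ itemCont (tr m) ψ ∧ liveTrapped c R k Z m

/-- The value of `ψ` is claimed to be high throughout `Z` if `Z` is closed. -/
def afSafe (c R k ψ Z : ℕ) : Prop :=
  afClosed c R k ψ Z → ∀ n < nodeBound c, bitOf Z n → cut k n ψ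

/-- Low values of items which may be postponed forever are justified. -/
def afOK (c R : ℕ) : Prop :=
  ∀ k < gridOf c, ∀ ψ < 5 * (c + 1), itemNext ψ = ψ → itemInf ψ → ∀ Z < 2 ^ nodeBound c,
    afSafe c R k ψ Z

/-- The set of nodes coded by `R` certifies satisfiability of the formula with code `c`. -/
def Cert (c R : ℕ) : Prop :=
  (∃ n < nodeBound c, bitOf R n ∧ tr n c) ∧
  (∀ n < nodeBound c, bitOf R n → localOK c n ∧ demandsOK c R n) ∧ euOK c R ∧ afOK c R

/-- The decision criterion. -/
def Accept (c : ℕ) : Prop := ∃ R < 2 ^ nodeBound c, Cert c R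

lemma exists_bits (N : ℕ) (Q : ℕ → Prop) : ∃ x < 2 ^ N, ∀ i, bitOf x i ↔ i < N ∧ Q i := by
  classical
  induction N with
  | zero => exact ⟨0, by norm_num, fun i => by simp [bitOf]⟩
  | succ N ih =>
    obtain ⟨x, hx, hQ⟩ := ih
    have key : ∀ y i, bitOf y i ↔ y.testBit i = true := fun y i => by
      rw [Nat.testBit_eq_decide_div_mod_eq, decide_eq_true_iff, bitOf]
    simp only [key] at hQ ⊢
    by_cases h : Q N
    · refine ⟨2 ^ N + x, by rw [pow_succ]; omega, fun i => ?_⟩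
      rcases lt_trichotomy i N with hi | rfl | hi
      · rw [Nat.testBit_two_pow_add_gt hi, hQ]
        simp only [hi, true_and, iff_and_self]
        omega
      · rw [Nat.testBit_two_pow_add_eq, Nat.testBit_lt_two_pow hx]
        simp [h]
      · rw [Nat.testBit_lt_two_pow]
        · simp; omega
        · calc 2 ^ N + x < 2 ^ N + 2 ^ N := by omega
            _ = 2 ^ (N + 1) := by ring
            _ ≤ 2 ^ i := Nat.pow_le_pow_right (by norm_num) hi
    · refine ⟨x, by rw [pow_succ]; omega, fun i => ?_⟩
      rw [hQ]
      constructor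
      · rintro ⟨h1, h2⟩; exact ⟨by omega, h2⟩
      · rintro ⟨h1, h2⟩
        refine ⟨?_, h2⟩
        rcases Nat.lt_succ_iff_lt_or_eq.1 h1 with h3 | rfl
        · exact h3
        · exact absurd h2 h

lemma lt_of_bitOf {x N i : ℕ} (hx : x < 2 ^ N) (h : bitOf x i) : i < N := by
  by_contra! hi
  have : x / 2 ^ i = 0 :=
    Nat.div_eq_of_lt (hx.trans_le (Nat.pow_le_pow_right (by norm_num) hi))
  simp [bitOf, this] at h

lemma gridOf_pos (c : ℕ) : 0 < gridOf c := Nat.factorial_pos _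

/-! ### The decision criterion is primitive recursive -/

attribute [fun_prop] Primrec PrimrecPred
attribute [fun_prop] Primrec.id Primrec.const Primrec.comp Primrec.fst Primrec.snd

section Primrec

variable {α : Type} [Primcodable α]
  {f g h u v w : α → ℕ} {p q : α → Prop}

@[fun_prop] lemma primrec_add (hf : Primrec f) (hg : Primrec g) : Primrec fun a => f a + g a :=
  Primrec.nat_add.comp hf hg
@[fun_prop] lemma primrec_sub (hf : Primrec f) (hg : Primrec g) : Primrec fun a => f a - g a :=
  Primrec.nat_sub.comp hf hg
@[fun_prop] lemma primrec_mul (hf : Primrec f) (hg : Primrec g) : Primrec fun a => f a * g a :=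
  Primrec.nat_mul.comp hf hg
@[fun_prop] lemma primrec_div (hf : Primrec f) (hg : Primrec g) : Primrec fun a => f a / g a :=
  Primrec.nat_div.comp hf hg
@[fun_prop] lemma primrec_mod (hf : Primrec f) (hg : Primrec g) : Primrec fun a => f a % g a :=
  Primrec.nat_mod.comp hf hg
@[fun_prop] lemma primrec_pow (hf : Primrec f) (hg : Primrec g) : Primrec fun a => f a ^ g a :=
  (Primrec₂.unpaired'.1 Nat.Primrec.pow).comp hf hg
@[fun_prop] lemma primrec_pair (hf : Primrec f) (hg : Primrec g) :
    Primrec fun a => Nat.pair (f a) (g a) :=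
  Primrec₂.natPair.comp hf hg
@[fun_prop] lemma primrec_unpair_fst (hf : Primrec f) : Primrec fun a => (f a).unpair.1 :=
  Primrec.fst.comp (Primrec.unpair.comp hf)
@[fun_prop] lemma primrec_unpair_snd (hf : Primrec f) : Primrec fun a => (f a).unpair.2 :=
  Primrec.snd.comp (Primrec.unpair.comp hf)
lemma primrec_ite (hp : PrimrecPred p) [DecidablePred p] (hf : Primrec f) (hg : Primrec g) :
    Primrec fun a => if p a then f a else g a :=
  Primrec.ite hp hf hg
@[fun_prop] lemma primrec_factorial (hf : Primrec f) : Primrec fun a => (f a).factorial := by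
  have : Primrec Nat.factorial := by
    refine (Primrec.nat_rec₁ (f := fun n m => (n + 1) * m) 1
      (Primrec.nat_mul.comp (Primrec.succ.comp Primrec.fst) Primrec.snd).to₂).of_eq fun n => ?_
    induction n with
    | zero => rfl
    | succ n ih => exact congrArg ((n + 1) * ·) ih
  exact this.comp hf

@[fun_prop] lemma primrecPred_le (hf : Primrec f) (hg : Primrec g) :
    PrimrecPred fun a => f a ≤ g a :=
  Primrec.nat_le.comp hf hg
@[fun_prop] lemma primrecPred_lt (hf : Primrec f) (hg : Primrec g) :
    PrimrecPred fun a => f a < g a :=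
  Primrec.nat_lt.comp hf hg
@[fun_prop] lemma primrecPred_eq (hf : Primrec f) (hg : Primrec g) :
    PrimrecPred fun a => f a = g a :=
  Primrec.eq.comp hf hg
@[fun_prop] lemma primrecPred_not (hp : PrimrecPred p) : PrimrecPred fun a => ¬p a :=
  hp.not
@[fun_prop] lemma primrecPred_and (hp : PrimrecPred p) (hq : PrimrecPred q) :
    PrimrecPred fun a => p a ∧ q a :=
  hp.and hq
@[fun_prop] lemma primrecPred_or (hp : PrimrecPred p) (hq : PrimrecPred q) :
    PrimrecPred fun a => p a ∨ q a :=
  hp.or hq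
lemma primrecPred_imp (hp : PrimrecPred p) (hq : PrimrecPred q) :
    PrimrecPred fun a => p a → q a :=
  (hp.not.or hq).of_eq fun _ => imp_iff_not_or.symm
@[fun_prop] lemma primrecPred_iff (hp : PrimrecPred p) (hq : PrimrecPred q) :
    PrimrecPred fun a => p a ↔ q a :=
  ((primrecPred_imp hp hq).and (primrecPred_imp hq hp)).of_eq fun _ =>
    iff_iff_implies_and_implies.symm

lemma primrecPred_exists {r : α → ℕ → Prop} (hf : Primrec f)
    (hr : PrimrecPred fun x : α × ℕ => r x.1 x.2) : PrimrecPred fun a => ∃ i < f a, r a i := by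
  have h : PrimrecRel fun (i : ℕ) (a : α) => r a i := hr.comp (Primrec.pair Primrec.snd Primrec.fst)
  exact (h.exists_mem_list.comp (Primrec.list_range.comp hf) Primrec.id).of_eq fun a => by simp

lemma primrecPred_forall {r : α → ℕ → Prop} (hf : Primrec f)
    (hr : PrimrecPred fun x : α × ℕ => r x.1 x.2) : PrimrecPred fun a => ∀ i < f a, r a i := by
  have h : PrimrecRel fun (i : ℕ) (a : α) => r a i := hr.comp (Primrec.pair Primrec.snd Primrec.fst)
  exact (h.forall_mem_list.comp (Primrec.list_range.comp hf) Primrec.id).of_eq fun a => by simp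

@[fun_prop] lemma primrec_tagOf (hf : Primrec f) : Primrec fun a => tagOf (f a) := by
  unfold tagOf; fun_prop
@[fun_prop] lemma primrec_argOf (hf : Primrec f) : Primrec fun a => argOf (f a) := by
  unfold argOf; fun_prop
@[fun_prop] lemma primrec_arg₁ (hf : Primrec f) : Primrec fun a => arg₁ (f a) := by
  unfold arg₁; fun_prop
@[fun_prop] lemma primrec_arg₂ (hf : Primrec f) : Primrec fun a => arg₂ (f a) := by
  unfold arg₂; fun_prop
@[fun_prop] lemma primrec_kindOf (hf : Primrec f) : Primrec fun a => kindOf (f a) := by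
  unfold kindOf; fun_prop
@[fun_prop] lemma primrec_bodyOf (hf : Primrec f) : Primrec fun a => bodyOf (f a) := by
  unfold bodyOf; fun_prop
@[fun_prop] lemma primrec_itemNext (hf : Primrec f) : Primrec fun a => itemNext (f a) := by
  unfold itemNext
  exact primrec_ite (by fun_prop) (by fun_prop) (primrec_ite (by fun_prop) (by fun_prop) hf)
@[fun_prop] lemma primrec_rg (hf : Primrec f) : Primrec fun a => rg (f a) := by
  unfold rg; fun_prop
@[fun_prop] lemma primrec_gridOf (hf : Primrec f) : Primrec fun a => gridOf (f a) := by
  unfold gridOf; fun_prop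
@[fun_prop] lemma primrec_nodeWidth (hf : Primrec f) : Primrec fun a => nodeWidth (f a) := by
  unfold nodeWidth; fun_prop
@[fun_prop] lemma primrec_nodeBound (hf : Primrec f) : Primrec fun a => nodeBound (f a) := by
  unfold nodeBound; fun_prop
@[fun_prop] lemma primrec_gridIdx (hf : Primrec f) (hg : Primrec g) :
    Primrec fun a => gridIdx (f a) (g a) := by
  unfold gridIdx; fun_prop
@[fun_prop] lemma primrecPred_bitOf (hf : Primrec f) (hg : Primrec g) :
    PrimrecPred fun a => bitOf (f a) (g a) := by
  unfold bitOf; fun_prop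
@[fun_prop] lemma primrecPred_tr (hf : Primrec f) (hg : Primrec g) :
    PrimrecPred fun a => tr (f a) (g a) := by
  unfold tr; fun_prop
@[fun_prop] lemma primrecPred_bs (hf : Primrec f) (hg : Primrec g) :
    PrimrecPred fun a => bs (f a) (g a) := by
  unfold bs; fun_prop
@[fun_prop] lemma primrecPred_gs (hf : Primrec f) (hg : Primrec g) (hh : Primrec h) :
    PrimrecPred fun a => gs (f a) (g a) (h a) := by
  unfold gs; fun_prop
@[fun_prop] lemma primrecPred_es (hf : Primrec f) (hg : Primrec g) (hh : Primrec h) :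
    PrimrecPred fun a => es (f a) (g a) (h a) := by
  unfold es; fun_prop
@[fun_prop] lemma primrecPred_itemNow (hf : Primrec f) (hg : Primrec g) :
    PrimrecPred fun a => itemNow (tr (f a)) (g a) := by
  unfold itemNow pathNow negNow; fun_prop
@[fun_prop] lemma primrecPred_itemCont (hf : Primrec f) (hg : Primrec g) :
    PrimrecPred fun a => itemCont (tr (f a)) (g a) := by
  unfold itemCont pathCont negCont; fun_prop
@[fun_prop] lemma primrecPred_itemInf (hf : Primrec f) : PrimrecPred fun a => itemInf (f a) := by
  unfold itemInf; fun_prop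
@[fun_prop] lemma primrecPred_geP (hf : Primrec f) (hg : Primrec g) (hh : Primrec h)
    (hu : Primrec u) : PrimrecPred fun a => geP (f a) (g a) (h a) (u a) := by
  unfold geP; fun_prop
@[fun_prop] lemma primrecPred_gtP (hf : Primrec f) (hg : Primrec g) (hh : Primrec h)
    (hu : Primrec u) : PrimrecPred fun a => gtP (f a) (g a) (h a) (u a) := by
  unfold gtP; fun_prop
@[fun_prop] lemma primrecPred_geN (hf : Primrec f) (hg : Primrec g) (hh : Primrec h)
    (hu : Primrec u) : PrimrecPred fun a => geN (f a) (g a) (h a) (u a) := by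
  unfold geN; fun_prop
@[fun_prop] lemma primrecPred_gtN (hf : Primrec f) (hg : Primrec g) (hh : Primrec h)
    (hu : Primrec u) : PrimrecPred fun a => gtN (f a) (g a) (h a) (u a) := by
  unfold gtN; fun_prop
lemma primrecPred_truthClause (hf : Primrec f) (hg : Primrec g) (hh : Primrec h) :
    PrimrecPred fun a => truthClause (f a) (g a) (h a) := by
  unfold truthClause inInterval
  refine .and (primrecPred_imp ?_ ?_) (.and (primrecPred_imp ?_ ?_) (.and (primrecPred_imp ?_ ?_)
    (.and (primrecPred_imp ?_ ?_) (.and (primrecPred_imp ?_ ?_) (primrecPred_imp ?_ ?_))))) <;>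
  fun_prop
@[fun_prop] lemma primrecPred_want (hf : Primrec f) (hg : Primrec g) (hh : Primrec h)
    (hu : Primrec u) : PrimrecPred fun a => want (f a) (g a) (h a) (u a) := by
  unfold want; fun_prop
@[fun_prop] lemma primrecPred_demand (hf : Primrec f) (hg : Primrec g) (hh : Primrec h)
    (hu : Primrec u) (hv : Primrec v) :
    PrimrecPred fun a => demand (f a) (g a) (h a) (u a) (v a) := by
  unfold demand; fun_prop
@[fun_prop] lemma primrecPred_live (hf : Primrec f) (hg : Primrec g) (hh : Primrec h) :
    PrimrecPred fun a => live (f a) (g a) (h a) := by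
  unfold live; fun_prop
@[fun_prop] lemma primrecPred_cut (hf : Primrec f) (hg : Primrec g) (hh : Primrec h) :
    PrimrecPred fun a => cut (f a) (g a) (h a) := by
  unfold cut; fun_prop
@[fun_prop] lemma primrecPred_edge (hf : Primrec f) (hg : Primrec g) (hh : Primrec h)
    (hu : Primrec u) (hv : Primrec v) (hw : Primrec w) :
    PrimrecPred fun a => edge (f a) (g a) (h a) (u a) (v a) (w a) := by
  unfold edge
  refine .and ?_ (.and ?_ (primrecPred_forall ?_ (primrecPred_imp ?_ (.and (primrecPred_imp ?_ ?_)
    (.and (primrecPred_forall ?_ (primrecPred_imp ?_ ?_))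
    (primrecPred_forall ?_ (primrecPred_imp ?_ ?_))))))) <;> fun_prop
@[fun_prop] lemma primrecPred_child {z : α → ℕ} (hf : Primrec f) (hg : Primrec g)
    (hh : Primrec h) (hu : Primrec u) (hv : Primrec v) (hw : Primrec w) (hz : Primrec z) :
    PrimrecPred fun a => child (f a) (g a) (h a) (u a) (v a) (w a) (z a) := by
  unfold child; fun_prop
@[fun_prop] lemma primrecPred_localOK (hf : Primrec f) (hg : Primrec g) :
    PrimrecPred fun a => localOK (f a) (g a) := by
  unfold localOK
  refine .and ?_ (.and (primrecPred_forall ?_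
    (primrecPred_truthClause ?_ ?_ ?_)) (.and ?_
    (primrecPred_forall ?_ (primrecPred_forall ?_ (.and
      (primrecPred_imp ?_ ?_) (.and
      (primrecPred_imp ?_ ?_) (primrecPred_imp ?_ (.and
      (primrecPred_imp ?_ ?_)
      (primrecPred_imp ?_ ?_))))))))) <;> fun_prop
@[fun_prop] lemma primrecPred_witnessed (hf : Primrec f) (hg : Primrec g) (hh : Primrec h)
    (hu : Primrec u) (hv : Primrec v) (hw : Primrec w) :
    PrimrecPred fun a => witnessed (f a) (g a) (h a) (u a) (v a) (w a) := by
  unfold witnessed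
  refine primrecPred_exists ?_ ?_ <;> fun_prop
@[fun_prop] lemma primrecPred_demandsOK (hf : Primrec f) (hg : Primrec g) (hh : Primrec h) :
    PrimrecPred fun a => demandsOK (f a) (g a) (h a) := by
  unfold demandsOK
  refine primrecPred_forall ?_ (primrecPred_forall ?_ (primrecPred_forall ?_
    (primrecPred_imp ?_ ?_))) <;> fun_prop
@[fun_prop] lemma primrecPred_euClosed (hf : Primrec f) (hg : Primrec g) (hh : Primrec h)
    (hu : Primrec u) : PrimrecPred fun a => euClosed (f a) (g a) (h a) (u a) := by
  unfold euClosed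
  refine primrecPred_forall ?_ (primrecPred_imp ?_ (.and ?_
    (.and ?_ (primrecPred_forall ?_ (primrecPred_imp ?_
    (primrecPred_imp ?_ ?_)))))) <;> fun_prop
@[fun_prop] lemma primrecPred_euOK (hf : Primrec f) (hg : Primrec g) :
    PrimrecPred fun a => euOK (f a) (g a) := by
  unfold euOK
  refine primrecPred_forall ?_ (primrecPred_imp ?_
    (primrecPred_imp ?_ (primrecPred_forall ?_
    (primrecPred_imp ?_ (primrecPred_forall ?_
    (primrecPred_imp ?_ ?_)))))) <;> fun_prop
@[fun_prop] lemma primrecPred_trapped {z : α → ℕ} (hf : Primrec f) (hg : Primrec g)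
    (hh : Primrec h) (hu : Primrec u) (hv : Primrec v) (hw : Primrec w) (hz : Primrec z) :
    PrimrecPred fun a => trapped (f a) (g a) (h a) (u a) (v a) (w a) (z a) := by
  unfold trapped
  refine primrecPred_forall ?_ (primrecPred_imp ?_ ?_) <;> fun_prop
@[fun_prop] lemma primrecPred_liveTrapped (hf : Primrec f) (hg : Primrec g) (hh : Primrec h)
    (hu : Primrec u) (hv : Primrec v) :
    PrimrecPred fun a => liveTrapped (f a) (g a) (h a) (u a) (v a) := by
  unfold liveTrapped
  refine primrecPred_exists ?_ (primrecPred_exists ?_ (primrecPred_exists ?_ ?_)) <;> fun_prop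
@[fun_prop] lemma primrecPred_afClosed (hf : Primrec f) (hg : Primrec g) (hh : Primrec h)
    (hu : Primrec u) (hv : Primrec v) :
    PrimrecPred fun a => afClosed (f a) (g a) (h a) (u a) (v a) := by
  unfold afClosed
  refine primrecPred_forall ?_ (primrecPred_imp ?_ ?_) <;> fun_prop
@[fun_prop] lemma primrecPred_afSafe (hf : Primrec f) (hg : Primrec g) (hh : Primrec h)
    (hu : Primrec u) (hv : Primrec v) :
    PrimrecPred fun a => afSafe (f a) (g a) (h a) (u a) (v a) := by
  unfold afSafe
  refine primrecPred_imp ?_ (primrecPred_forall ?_ (primrecPred_imp ?_ ?_)) <;> fun_prop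
@[fun_prop] lemma primrecPred_afOK (hf : Primrec f) (hg : Primrec g) :
    PrimrecPred fun a => afOK (f a) (g a) := by
  unfold afOK
  refine primrecPred_forall ?_ (primrecPred_forall ?_ (primrecPred_imp ?_ (primrecPred_imp ?_
    (primrecPred_forall ?_ ?_)))) <;> fun_prop
lemma primrecPred_accept : PrimrecPred Accept := by
  unfold Accept Cert
  refine primrecPred_exists ?_ (.and (primrecPred_exists ?_ ?_)
    (.and (primrecPred_forall ?_ (primrecPred_imp ?_ ?_))
    ?_)) <;> fun_prop

end Primrec

/-! ### Possibilities of items -/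

namespace PKS

variable (M : PKS S A)

/-- The supremum of the possibilities of the paths from `s` fulfilling the item `φ`, where `T`
gives the truth values of state formulae. -/
noncomputable def val (T : S → ℕ → Prop) (s : S) (φ : ℕ) : ℝ :=
  sSup {x : ℝ | ∃ π : ℕ → S,
    M.IsPath π ∧ π 0 = s ∧ psat (fun j => T (π j)) φ ∧ x = M.poPathFrom π}

lemma exists_lt_P (s : S) {y : ℝ} (hy : y < 1) : ∃ t, y < M.P s t := by
  have := M.nonempty
  rw [← M.P_sup s] at hy
  exact exists_lt_of_lt_ciSup hy

lemma exists_path (s : S) {y : ℝ} (hy : y < 1) :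
    ∃ π : ℕ → S, π 0 = s ∧ ∀ i, y < M.P (π i) (π (i + 1)) := by
  choose f hf using fun s => M.exists_lt_P s hy
  exact ⟨fun i => f^[i] s, rfl, fun i => by
    simp only [Function.iterate_succ_apply']; exact hf _⟩

lemma poPathFrom_le (π : ℕ → S) (i : ℕ) : M.poPathFrom π ≤ M.P (π i) (π (i + 1)) :=
  ciInf_le ⟨0, by rintro _ ⟨j, rfl⟩; exact M.P_nonneg _ _⟩ i

lemma le_poPathFrom {π : ℕ → S} {z : ℝ} (h : ∀ i, z ≤ M.P (π i) (π (i + 1))) :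
    z ≤ M.poPathFrom π := le_ciInf h

variable {M} {T : S → ℕ → Prop} {s t : S} {φ : ℕ} {y z : ℝ}

lemma val_nonneg : 0 ≤ M.val T s φ := by
  apply Real.sSup_nonneg
  rintro _ ⟨π, -, -, -, rfl⟩
  exact M.le_poPathFrom fun i => M.P_nonneg _ _

lemma poPathFrom_le_one (π : ℕ → S) : M.poPathFrom π ≤ 1 :=
  (M.poPathFrom_le π 0).trans (M.P_le_one _ _)

lemma val_le_one : M.val T s φ ≤ 1 := by
  apply Real.sSup_le _ zero_le_one
  rintro _ ⟨π, -, -, -, rfl⟩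
  exact poPathFrom_le_one π

lemma le_val {π : ℕ → S} (hz : 0 < z) (h : ∀ i, z ≤ M.P (π i) (π (i + 1)))
    (hφ : psat (fun j => T (π j)) φ) : z ≤ M.val T (π 0) φ :=
  (M.le_poPathFrom h).trans <| le_csSup
    ⟨1, by rintro _ ⟨π, -, -, -, rfl⟩; exact poPathFrom_le_one π⟩
    ⟨π, fun i => hz.trans_le (h i), rfl, hφ, rfl⟩

lemma exists_path_of_lt_val (hy : 0 ≤ y) (h : y < M.val T s φ) :
    ∃ π : ℕ → S, ∃ z, y < z ∧ π 0 = s ∧ (∀ i, z ≤ M.P (π i) (π (i + 1))) ∧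
      psat (fun j => T (π j)) φ := by
  have hne : {x : ℝ | ∃ π : ℕ → S,
      M.IsPath π ∧ π 0 = s ∧ psat (fun j => T (π j)) φ ∧ x = M.poPathFrom π}.Nonempty := by
    by_contra hn
    rw [Set.not_nonempty_iff_eq_empty] at hn
    rw [val, hn, Real.sSup_empty] at h
    exact absurd h hy.not_gt
  obtain ⟨_, ⟨π, -, h0, hφ, rfl⟩, hlt⟩ := exists_lt_of_lt_csSup hne h
  exact ⟨π, _, hlt, h0, M.poPathFrom_le π, hφ⟩

lemma val_congr {T' : S → ℕ → Prop} (h : ∀ s, ∀ a ≤ bodyOf φ, T s a ↔ T' s a) :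
    M.val T s φ = M.val T' s φ := by
  unfold val
  congr 1
  ext x
  refine exists_congr fun π => and_congr_right fun _ => and_congr_right fun _ =>
    and_congr_left fun _ => psat_congr fun j a ha => h _ a ha

lemma val_of_now (h : itemNow (T s) φ) : M.val T s φ = 1 := by
  refine le_antisymm val_le_one (le_of_forall_lt_imp_le_of_dense fun y hy => ?_)
  obtain ⟨π, rfl, hπ⟩ := M.exists_path s (max_lt hy (by norm_num : (1 / 2 : ℝ) < 1))
  refine (le_max_left y (1 / 2)).trans (le_val (by positivity) (fun i => (hπ i).le) ?_)
  rw [psat_unfold]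
  exact Or.inl h

lemma val_true : M.val T s 4 = 1 := by
  refine le_antisymm val_le_one (le_of_forall_lt_imp_le_of_dense fun y hy => ?_)
  obtain ⟨π, rfl, hπ⟩ := M.exists_path s (max_lt hy (by norm_num : (1 / 2 : ℝ) < 1))
  exact (le_max_left y (1 / 2)).trans
    (le_val (by positivity) (fun i => (hπ i).le) (psat_true _))

lemma exists_step (hy : 0 ≤ y) (h : y < M.val T s φ) (hn : ¬itemNow (T s) φ) :
    itemCont (T s) φ ∧ ∃ t, y < M.P s t ∧ y < M.val T t (itemNext φ) := by
  obtain ⟨π, z, hz, rfl, hπ, hφ⟩ := exists_path_of_lt_val hy h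
  rw [psat_unfold] at hφ
  obtain ⟨hc, hφ⟩ := hφ.resolve_left hn
  exact ⟨hc, π 1, hz.trans_le (hπ 0), hz.trans_le <|
    le_val (π := fun j => π (j + 1)) (hy.trans_lt hz) (fun i => hπ (i + 1)) hφ⟩

lemma lt_val_of_step (hy : 0 ≤ y) (hc : itemCont (T s) φ) (hP : y < M.P s t)
    (h : y < M.val T t (itemNext φ)) : y < M.val T s φ := by
  obtain ⟨π, z, hz, h0, hπ, hφ⟩ := exists_path_of_lt_val hy h
  let σ : ℕ → S := fun n => Nat.casesOn n s π
  have hlt : y < min z (M.P s t) := lt_min hz hP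
  refine hlt.trans_le (le_val (π := σ) (hy.trans_lt hlt) (fun i => ?_) ?_)
  · cases i with
    | zero => simp only [σ, h0]; exact min_le_right _ _
    | succ i => exact (min_le_left _ _).trans (hπ i)
  · rw [psat_unfold]
    exact Or.inr ⟨hc, hφ⟩

lemma le_val_of_step (hc : itemCont (T s) φ) (hP : z ≤ M.P s t)
    (h : z ≤ M.val T t (itemNext φ)) : z ≤ M.val T s φ := by
  refine le_of_forall_lt_imp_le_of_dense fun y hy => ?_
  rcases lt_or_ge y 0 with h0 | h0
  · exact h0.le.trans val_nonneg
  · exact (lt_val_of_step h0 hc (hy.trans_le hP) (hy.trans_le h)).le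

end PKS

/-! ### Comparisons with rational bounds -/

lemma ratOfCode_of_odd {e : ℕ} (h : tagOf e % 2 = 1) : (ratOfCode e : ℝ) < 0 := by
  have h0 : ratOfCode e < 0 := by
    unfold ratOfCode
    rw [if_pos h, neg_lt_zero]
    apply div_pos
    · positivity
    · simp
  exact_mod_cast h0

lemma ratOfCode_of_even {c e : ℕ} (he : e ≤ c) (h : tagOf e % 2 ≠ 1) :
    (ratOfCode e : ℝ) = gridIdx c e / gridOf c := by
  unfold ratOfCode gridIdx
  rw [if_neg h]
  rcases Nat.eq_zero_or_pos (argOf e) with h0 | h0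
  · simp [h0]
  · have hd : argOf e ∣ gridOf c :=
      Nat.dvd_factorial h0 ((argOf_le e).trans (by omega))
    have hK : (gridOf c : ℝ) ≠ 0 := by exact_mod_cast (gridOf_pos c).ne'
    have ha : (argOf e : ℝ) ≠ 0 := by exact_mod_cast h0.ne'
    push_cast [Nat.cast_div hd ha]
    field_simp

/-- The comparisons of `φ` with the grid recorded in the node `n` are those of `x`. -/
def GridSpec (c n φ : ℕ) (x : ℝ) : Prop :=
  0 ≤ x ∧ x ≤ 1 ∧ ∀ k < gridOf c, (gs n k φ ↔ (k : ℝ) / gridOf c < x) ∧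
    (es n k φ ↔ ((k : ℝ) + 1) / gridOf c ≤ x)

section Compare

variable {c n φ e : ℕ} {x : ℝ}

lemma geP_iff (h : GridSpec c n φ x) (he : e ≤ c) : geP c n φ e ↔ (ratOfCode e : ℝ) ≤ x := by
  obtain ⟨h0, h1, hk⟩ := h
  have hK : (0 : ℝ) < gridOf c := by exact_mod_cast gridOf_pos c
  unfold geP
  by_cases ho : tagOf e % 2 = 1
  · simpa [ho] using (ratOfCode_of_odd ho).le.trans h0
  · rw [ratOfCode_of_even he ho]
    rcases Nat.eq_zero_or_pos (gridIdx c e) with hz | hz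
    · simp [hz, h0]
    · have hc : ((gridIdx c e - 1 : ℕ) : ℝ) + 1 = gridIdx c e := by
        exact_mod_cast Nat.sub_add_cancel hz
      simp only [ho, hz.ne', false_or]
      constructor
      · rintro ⟨hle, hes⟩
        rwa [(hk _ (by omega)).2, hc] at hes
      · intro hx
        have hle : gridIdx c e ≤ gridOf c := by
          have := hx.trans h1
          rw [div_le_one hK] at this
          exact_mod_cast this
        exact ⟨hle, by rwa [(hk _ (by omega)).2, hc]⟩

lemma gtP_iff (h : GridSpec c n φ x) (he : e ≤ c) : gtP c n φ e ↔ (ratOfCode e : ℝ) < x := by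
  obtain ⟨h0, h1, hk⟩ := h
  have hK : (0 : ℝ) < gridOf c := by exact_mod_cast gridOf_pos c
  unfold gtP
  by_cases ho : tagOf e % 2 = 1
  · simpa [ho] using (ratOfCode_of_odd ho).trans_le h0
  · rw [ratOfCode_of_even he ho]
    simp only [ho, false_or]
    constructor
    · rintro ⟨hle, hgs⟩
      rwa [(hk _ hle).1] at hgs
    · intro hx
      have hle : gridIdx c e < gridOf c := by
        have := hx.trans_le h1
        rw [div_lt_one hK] at this
        exact_mod_cast this
      exact ⟨hle, by rwa [(hk _ hle).1]⟩

lemma geN_iff (h : GridSpec c n φ x) (he : e ≤ c) :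
    geN c n φ e ↔ (ratOfCode e : ℝ) ≤ 1 - x := by
  obtain ⟨h0, h1, hk⟩ := h
  have hK : (0 : ℝ) < gridOf c := by exact_mod_cast gridOf_pos c
  unfold geN
  by_cases ho : tagOf e % 2 = 1
  · simpa [ho] using (ratOfCode_of_odd ho).le.trans (by linarith)
  · rw [ratOfCode_of_even he ho]
    rcases Nat.eq_zero_or_pos (gridIdx c e) with hz | hz
    · simp [hz, h1]
    · simp only [ho, hz.ne', false_or]
      have key : ∀ hle : gridIdx c e ≤ gridOf c,
          (¬gs n (gridOf c - gridIdx c e) φ ↔ (gridIdx c e : ℝ) / gridOf c ≤ 1 - x) := by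
        intro hle
        rw [(hk _ (by omega)).1, Nat.cast_sub hle, sub_div, div_self hK.ne', not_lt]
        constructor <;> intro <;> linarith
      constructor
      · rintro ⟨hle, hgs⟩
        exact (key hle).1 hgs
      · intro hx
        have hle : gridIdx c e ≤ gridOf c := by
          have : (gridIdx c e : ℝ) / gridOf c ≤ 1 := by linarith
          rw [div_le_one hK] at this
          exact_mod_cast this
        exact ⟨hle, (key hle).2 hx⟩

lemma gtN_iff (h : GridSpec c n φ x) (he : e ≤ c) :
    gtN c n φ e ↔ (ratOfCode e : ℝ) < 1 - x := by
  obtain ⟨h0, h1, hk⟩ := h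
  have hK : (0 : ℝ) < gridOf c := by exact_mod_cast gridOf_pos c
  unfold gtN
  by_cases ho : tagOf e % 2 = 1
  · simpa [ho] using (ratOfCode_of_odd ho).trans_le (by linarith)
  · rw [ratOfCode_of_even he ho]
    simp only [ho, false_or]
    have key : ∀ hle : gridIdx c e < gridOf c,
        (¬es n (gridOf c - gridIdx c e - 1) φ ↔ (gridIdx c e : ℝ) / gridOf c < 1 - x) := by
      intro hle
      have hc : ((gridOf c - gridIdx c e - 1 : ℕ) : ℝ) + 1 = gridOf c - gridIdx c e := by
        rw [← Nat.cast_sub hle.le]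
        exact_mod_cast Nat.sub_add_cancel (Nat.sub_pos_of_lt hle)
      rw [(hk _ (by omega)).2, hc, sub_div, div_self hK.ne', not_le]
      constructor <;> intro <;> linarith
    constructor
    · rintro ⟨hle, hes⟩
      exact (key hle).1 hes
    · intro hx
      have hle : gridIdx c e < gridOf c := by
        have : (gridIdx c e : ℝ) / gridOf c < 1 := by linarith
        rw [div_lt_one hK] at this
        exact_mod_cast this
      exact ⟨hle, (key hle).2 hx⟩

lemma inInterval_iff {ge gt : ℕ → Prop} {J : ℕ} (hJ : J ≤ c)
    (hge : ∀ e ≤ c, ge e ↔ (ratOfCode e : ℝ) ≤ x) (hgt : ∀ e ≤ c, gt e ↔ (ratOfCode e : ℝ) < x) :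
    inInterval ge gt J ↔ (intervalOfCode J).mem x := by
  have h1 := (arg₁_le J).trans hJ
  have h2 := (arg₂_le J).trans hJ
  unfold inInterval
  rw [hge _ h1, hgt _ h1, hge _ h2, hgt _ h2, intervalOfCode]
  split_ifs with a b d <;> simp only [RatInterval.mem]
  · simp [a]
  · simp [b]
  · simp [d]
  · have : ¬ tagOf J < 2 := by omega
    simp [a, d, this]

lemma inInterval_pos (h : GridSpec c n φ x) {J : ℕ} (hJ : J ≤ c) :
    inInterval (geP c n φ) (gtP c n φ) J ↔ (intervalOfCode J).mem x :=
  inInterval_iff hJ (fun _ he => geP_iff h he) fun _ he => gtP_iff h he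

lemma inInterval_neg (h : GridSpec c n φ x) {J : ℕ} (hJ : J ≤ c) :
    inInterval (geN c n φ) (gtN c n φ) J ↔ (intervalOfCode J).mem (1 - x) :=
  inInterval_iff hJ (fun _ he => geN_iff h he) fun _ he => gtN_iff h he

end Compare

/-! ### Correctness of local truth values -/

namespace PKS

/-- The truth value of the state formula with code `a`. -/
def sat (M : PKS S ℕ) (s : S) (a : ℕ) : Prop := (stateOfCode a).Sat M s

variable {M : PKS S ℕ} {s : S} {p : ℕ} {J : RatInterval}

lemma sat_po : (SF.po J (pathOfCode p)).Sat M s ↔ J.mem (M.val M.sat s (5 * p + 0)) := by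
  have h : ∀ π : ℕ → S, (pathOfCode p).Sat M π ↔ psat (fun j => M.sat (π j)) (5 * p + 0) :=
    fun π => ((psat_path M π fun _ _ => Iff.rfl).1).symm
  simp only [SF.Sat, val, h]

lemma sat_ne : (SF.ne J (pathOfCode p)).Sat M s ↔ J.mem (1 - M.val M.sat s (5 * p + 1)) := by
  have h : ∀ π : ℕ → S, ¬(pathOfCode p).Sat M π ↔ psat (fun j => M.sat (π j)) (5 * p + 1) :=
    fun π => ((psat_path M π fun _ _ => Iff.rfl).2).symm
  simp only [SF.Sat, val, h]

lemma truthClause_iff {c n a : ℕ} (ha : a < c + 1) (hlt : ∀ b < a, tr n b ↔ M.sat s b)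
    (hspec : ∀ φ, bodyOf φ < a → GridSpec c n φ (M.val M.sat s φ)) :
    truthClause c n a ↔ (tagOf a ≠ 1 → (tr n a ↔ M.sat s a)) := by
  have h5 : tagOf a = 5 → (inInterval (geP c n (5 * arg₂ a + 0)) (gtP c n (5 * arg₂ a + 0))
      (arg₁ a) ↔ (intervalOfCode (arg₁ a)).mem (M.val M.sat s (5 * arg₂ a + 0))) := fun h =>
    inInterval_pos (hspec _ (by rw [bodyOf_add (by omega)]; exact arg₂_lt (by omega)))
      ((arg₁_le a).trans (by omega))
  have h6 : tagOf a = 6 → (inInterval (geN c n (5 * arg₂ a + 1)) (gtN c n (5 * arg₂ a + 1))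
      (arg₁ a) ↔ (intervalOfCode (arg₁ a)).mem (1 - M.val M.sat s (5 * arg₂ a + 1))) := fun h =>
    inInterval_neg (hspec _ (by rw [bodyOf_add (by omega)]; exact arg₂_lt (by omega)))
      ((arg₁_le a).trans (by omega))
  have hl (h : tagOf a ≠ 0) := hlt _ (arg₁_lt h)
  have hr (h : tagOf a ≠ 0) := hlt _ (arg₂_lt h)
  have hu (h : tagOf a ≠ 0) := hlt _ (argOf_lt h)
  have hs : M.sat s a ↔ (stateOfCode a).Sat M s := Iff.rfl
  rw [stateOfCode] at hs
  unfold truthClause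
  by_cases t1 : tagOf a = 1
  · simp [t1]
  by_cases t2 : tagOf a = 2
  · simp only [t2, hl (by omega), hr (by omega)] at hs ⊢
    norm_num [SF.Sat] at hs
    rw [hs]
    simp [sat]
  by_cases t3 : tagOf a = 3
  · simp only [t3, hl (by omega), hr (by omega)] at hs ⊢
    norm_num [SF.Sat] at hs
    rw [hs]
    simp [sat]
  by_cases t4 : tagOf a = 4
  · simp only [t4, hu (by omega)] at hs ⊢
    norm_num [SF.Sat] at hs
    rw [hs]
    simp [sat]
  by_cases t5 : tagOf a = 5
  · simp only [t5, h5 t5] at hs ⊢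
    norm_num at hs
    rw [sat_po] at hs
    simp [hs]
  by_cases t6 : tagOf a = 6
  · simp only [t6, h6 t6] at hs ⊢
    norm_num at hs
    rw [sat_ne] at hs
    simp [hs]
  have t7 : tagOf a = 0 ∨ 7 ≤ tagOf a := by omega
  simp only [t1, t2, t3, t4, t5, t6, dite_false, if_false, SF.Sat] at hs
  simp [t1, t2, t3, t4, t5, t6, t7, hs]

end PKS

/-! ### Satisfiable formulae have certificates -/

lemma exists_between_avoiding (f : ℕ → ℝ) (N : ℕ) {a u : ℝ} (h : a < u) :
    ∃ y, a < y ∧ y < u ∧ ∀ χ < N, y < f χ → u ≤ f χ := by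
  induction N with
  | zero => obtain ⟨y, h1, h2⟩ := exists_between h; exact ⟨y, h1, h2, by simp⟩
  | succ N ih =>
    obtain ⟨y, h1, h2, h3⟩ := ih
    rcases le_or_gt u (f N) with hu | hu
    · refine ⟨y, h1, h2, fun χ hχ hy => ?_⟩
      rcases Nat.lt_succ_iff_lt_or_eq.1 hχ with hlt | rfl
      · exact h3 χ hlt hy
      · exact hu
    · refine ⟨max y (f N), lt_max_of_lt_left h1, max_lt h2 hu, fun χ hχ hy => ?_⟩
      rcases Nat.lt_succ_iff_lt_or_eq.1 hχ with hlt | rfl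
      · exact h3 χ hlt ((le_max_left _ _).trans_lt hy)
      · exact absurd hy (le_max_right _ _).not_gt

lemma exists_gt_preserving (f : ℕ → ℝ) (N : ℕ) {a u : ℝ} (h : a < u) :
    ∃ y, a < y ∧ y < u ∧ ∀ χ < N, a < f χ → y < f χ := by
  induction N with
  | zero => obtain ⟨y, h1, h2⟩ := exists_between h; exact ⟨y, h1, h2, by simp⟩
  | succ N ih =>
    obtain ⟨y, h1, h2, h3⟩ := ih
    rcases lt_or_ge a (f N) with hu | hu
    · obtain ⟨z, hz1, hz2⟩ := exists_between (lt_min h1 hu)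
      refine ⟨z, hz1, (hz2.trans_le (min_le_left _ _)).trans h2, fun χ hχ hy => ?_⟩
      rcases Nat.lt_succ_iff_lt_or_eq.1 hχ with hlt | rfl
      · exact (hz2.trans_le (min_le_left _ _)).trans (h3 χ hlt hy)
      · exact hz2.trans_le (min_le_right _ _)
    · refine ⟨y, h1, h2, fun χ hχ hy => ?_⟩
      rcases Nat.lt_succ_iff_lt_or_eq.1 hχ with hlt | rfl
      · exact h3 χ hlt hy
      · exact absurd hy hu.not_gt

/-- The node `n` describes the state `s` with threshold `y`. -/
structure Describes (M : PKS S ℕ) (c : ℕ) (s : S) (y : ℝ) (n : ℕ) : Prop where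
  bound : n < nodeBound c
  region : rg n < gridOf c
  lower : (rg n : ℝ) / gridOf c < y
  upper : y < ((rg n : ℝ) + 1) / gridOf c
  truth : ∀ a < c + 1, tr n a ↔ M.sat s a
  above : ∀ φ < 5 * (c + 1), bs n φ ↔ y < M.val M.sat s φ
  grid : ∀ φ < 5 * (c + 1), GridSpec c n φ (M.val M.sat s φ)

/-- The set of nodes describing some state. -/
def describing (M : PKS S ℕ) (c n : ℕ) : Prop := ∃ s y, Describes M c s y n

lemma digit_lt {c k φ i : ℕ} (hk : k < gridOf c) (hφ : φ < 5 * (c + 1)) (hi : i < 4) :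
    4 * Nat.pair k φ + i < nodeWidth c := by
  have : Nat.pair k φ < Nat.pair (gridOf c) (5 * (c + 1)) :=
    (Nat.pair_lt_pair_left _ hk).trans (Nat.pair_lt_pair_right _ hφ)
  unfold nodeWidth
  omega

lemma digit_lt' {c φ i : ℕ} (hφ : φ < 5 * (c + 1)) (hi : i < 4) :
    4 * φ + i < nodeWidth c := by
  have := Nat.add_le_pair (gridOf c) (5 * (c + 1))
  unfold nodeWidth
  omega

lemma exists_describes (M : PKS S ℕ) {c k : ℕ} (hk : k < gridOf c) (s : S) {y : ℝ}
    (h1 : (k : ℝ) / gridOf c < y) (h2 : y < ((k : ℝ) + 1) / gridOf c) :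
    ∃ n, Describes M c s y n ∧ rg n = k := by
  obtain ⟨x, hx, hb⟩ := exists_bits (nodeWidth c) fun i =>
    (i % 4 = 0 ∧ M.sat s (i / 4)) ∨ (i % 4 = 1 ∧ y < M.val M.sat s (i / 4)) ∨
    (i % 4 = 2 ∧ ((i / 4).unpair.1 : ℝ) / gridOf c < M.val M.sat s (i / 4).unpair.2) ∨
    (i % 4 = 3 ∧ (((i / 4).unpair.1 : ℝ) + 1) / gridOf c ≤ M.val M.sat s (i / 4).unpair.2)
  have d1 (m : ℕ) : (4 * m + 1) / 4 = m := by omega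
  have d2 (m : ℕ) : (4 * m + 2) / 4 = m := by omega
  have d3 (m : ℕ) : (4 * m + 3) / 4 = m := by omega
  have hrg : rg (Nat.pair k x) = k := by simp [rg]
  refine ⟨Nat.pair k x, ⟨?_, ?_, ?_, ?_, fun a ha => ?_, fun φ hφ => ?_, fun φ hφ => ?_⟩, hrg⟩
  · exact (Nat.pair_lt_pair_left _ hk).trans (Nat.pair_lt_pair_right _ hx)
  · rwa [hrg]
  · rwa [hrg]
  · rwa [hrg]
  · have hlt : 4 * a < nodeWidth c := digit_lt' (i := 0) (by omega) (by omega)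
    simp [tr, hb, hlt]
  · simp [bs, hb, digit_lt' hφ (show 1 < 4 by omega), Nat.add_mod, d1]
  · refine ⟨PKS.val_nonneg, PKS.val_le_one, fun k hk => ⟨?_, ?_⟩⟩
    · simp [gs, hb, digit_lt hk hφ (show 2 < 4 by omega), Nat.add_mod, d2]
    · simp [es, hb, digit_lt hk hφ (show 3 < 4 by omega), Nat.add_mod, d3]

section Describes

variable {M : PKS S ℕ} {c n n' : ℕ} {s t : S} {y y' : ℝ}

lemma gridOf_cast_pos (c : ℕ) : (0 : ℝ) < gridOf c := by exact_mod_cast gridOf_pos c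

lemma grid_mono {c i j : ℕ} (h : i ≤ j) : (i : ℝ) / gridOf c ≤ (j : ℝ) / gridOf c := by
  have := gridOf_cast_pos c
  gcongr

lemma grid_succ_le {c i j : ℕ} (h : i < j) : ((i : ℝ) + 1) / gridOf c ≤ (j : ℝ) / gridOf c := by
  exact_mod_cast grid_mono (c := c) h

lemma Describes.pos (h : Describes M c s y n) : 0 < y :=
  lt_of_le_of_lt (by positivity) h.lower

lemma Describes.now_iff (h : Describes M c s y n) {φ : ℕ} (hφ : φ < 5 * (c + 1)) :
    itemNow (tr n) φ ↔ itemNow (M.sat s) φ :=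
  itemNow_congr fun a ha => h.truth a (ha.trans_lt (item_lt_iff.1 hφ))

lemma Describes.cont_iff (h : Describes M c s y n) {φ : ℕ} (hφ : φ < 5 * (c + 1)) :
    itemCont (tr n) φ ↔ itemCont (M.sat s) φ :=
  itemCont_congr fun a ha => h.truth a (ha.trans_lt (item_lt_iff.1 hφ))

lemma Describes.edge {R r : ℕ} (h : Describes M c s y n) (h' : Describes M c t y' n')
    (hR : bitOf R n') (hP : y' < M.P s t)
    (hw : ∀ χ < 5 * (c + 1), y' < M.val M.sat s χ → want n r (rg n') χ) :
    edge c R n r (rg n') n' := by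
  refine ⟨hR, rfl, fun χ hχ hc => ?_⟩
  rw [h.cont_iff hχ] at hc
  have hχ' := itemNext_lt hχ
  refine ⟨fun hb => ?_, fun j hj he => ?_, fun j hj hg => ?_⟩
  · rw [h'.above _ hχ'] at hb
    exact hw χ hχ (PKS.lt_val_of_step h'.pos.le hc hP hb)
  · have hjK := hj.trans h'.region
    rw [((h'.grid _ hχ').2.2 j hjK).2] at he
    rw [((h.grid _ hχ).2.2 j hjK).2]
    exact PKS.le_val_of_step hc
      (((grid_succ_le hj).trans_lt h'.lower).trans hP).le he
  · have hjK : j < gridOf c := by have := h'.region; omega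
    rw [((h'.grid _ hχ').2.2 j hjK).1] at hg
    rw [((h.grid _ hχ).2.2 j hjK).1]
    exact PKS.lt_val_of_step (by positivity) hc
      (((grid_mono (by omega)).trans_lt h'.lower).trans hP) hg

lemma Describes.exists_child {R r k φ : ℕ} {z : ℝ}
    (hR : ∀ n, bitOf R n ↔ n < nodeBound c ∧ describing M c n)
    (h : Describes M c s y n) (hd : demand c n r k φ) (hz : z < ((k : ℝ) + 1) / gridOf c) :
    ∃ t y' n', Describes M c t y' n' ∧ child c R n r k φ n' ∧ y' < M.P s t ∧
      (r = 1 → z < y') ∧ (r = 2 → y' = y) := by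
  obtain ⟨hr, hk, hφ, hw, hn⟩ := hd
  rw [h.now_iff hφ] at hn
  have hK := gridOf_cast_pos c
  have key : ∃ y' : ℝ, (k : ℝ) / gridOf c < y' ∧ y' < ((k : ℝ) + 1) / gridOf c ∧
      y' < M.val M.sat s φ ∧ (r = 1 → z < y') ∧ (r = 2 → y' = y) ∧
      ∀ χ < 5 * (c + 1), y' < M.val M.sat s χ → want n r k χ := by
    have hlt : (k : ℝ) / gridOf c < ((k : ℝ) + 1) / gridOf c := by gcongr; linarith
    rcases hw with ⟨rfl, hg⟩ | ⟨rfl, he⟩ | ⟨rfl, rfl, hb⟩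
    · rw [((h.grid _ hφ).2.2 k hk).1] at hg
      obtain ⟨y', h1, h2⟩ := exists_between (lt_min hlt hg)
      refine ⟨y', h1, h2.trans_le (min_le_left _ _), h2.trans_le (min_le_right _ _),
        by simp, by simp, fun χ hχ hy => Or.inl ⟨rfl, ?_⟩⟩
      rw [((h.grid _ hχ).2.2 k hk).1]
      exact h1.trans hy
    · rw [((h.grid _ hφ).2.2 k hk).2] at he
      obtain ⟨y', h1, h2, h3⟩ :=
        exists_between_avoiding (M.val M.sat s) (5 * (c + 1)) (max_lt hlt hz)
      refine ⟨y', (le_max_left _ _).trans_lt h1, h2, h2.trans_le he,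
        fun _ => (le_max_right _ _).trans_lt h1, by simp,
        fun χ hχ hy => Or.inr (Or.inl ⟨rfl, ?_⟩)⟩
      rw [((h.grid _ hχ).2.2 k hk).2]
      exact h3 χ hχ hy
    · rw [h.above _ hφ] at hb
      exact ⟨y, h.lower, h.upper, hb, by simp, by simp, fun χ hχ hy =>
        Or.inr (Or.inr ⟨rfl, rfl, (h.above _ hχ).2 hy⟩)⟩
  obtain ⟨y', h1, h2, h3, h4, h5, h6⟩ := key
  have h0 : 0 ≤ y' := le_trans (by positivity) h1.le
  obtain ⟨hc, t, hP, hv⟩ := PKS.exists_step h0 h3 hn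
  obtain ⟨n', hn', rfl⟩ := exists_describes M hk t h1 h2
  exact ⟨t, y', n', hn', ⟨h.edge hn' ((hR n').2 ⟨hn'.bound, t, y', hn'⟩) hP h6,
    (h.cont_iff hφ).2 hc, (hn'.above _ (itemNext_lt hφ)).2 hv⟩, hP, h4, h5⟩

lemma Describes.localOK (h : Describes M c s y n) : localOK c n := by
  have hK := gridOf_cast_pos c
  refine ⟨h.region, fun a ha => ?_, ?_, fun k hk φ hφ => ⟨fun hn => ?_, fun he => ?_, ?_⟩⟩
  · rw [PKS.truthClause_iff (s := s) (M := M) ha (fun b hb => h.truth b (hb.trans ha))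
      fun φ hφ => h.grid φ (item_lt_iff.2 (hφ.trans ha))]
    exact fun _ => h.truth a ha
  · have := gridOf_pos c
    rw [((h.grid 4 (by omega)).2.2 _ (by omega)).2, PKS.val_true, div_le_one hK]
    exact_mod_cast (Nat.sub_add_cancel this).le
  · rw [h.now_iff hφ] at hn
    rw [((h.grid _ hφ).2.2 k hk).2, PKS.val_of_now hn, div_le_one hK]
    exact_mod_cast hk
  · rw [((h.grid _ hφ).2.2 k hk).2] at he
    rw [((h.grid _ hφ).2.2 k hk).1]
    exact lt_of_lt_of_le (by gcongr; linarith) he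
  · rintro rfl
    rw [((h.grid _ hφ).2.2 _ hk).2, ((h.grid _ hφ).2.2 _ hk).1, h.above _ hφ]
    exact ⟨h.upper.trans_le, h.lower.trans⟩

lemma euOK_describing {R : ℕ} (hR : ∀ n, bitOf R n ↔ n < nodeBound c ∧ describing M c n) :
    euOK c R := by
  intro φ hφ hfix hinf Z _ hZ n hn hnZ hb
  obtain ⟨s, y, h⟩ := ((hR n).1 (hZ n hn hnZ).1).2
  rw [h.above _ hφ] at hb
  obtain ⟨π, z, hz, rfl, hπ, hψ⟩ := PKS.exists_path_of_lt_val h.pos.le hb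
  rw [psat_of_fixed hfix] at hψ
  obtain ⟨j, hj, hc⟩ := hψ.resolve_right fun h => hinf h.1
  have key : ∀ i ≤ j, ∃ m, bitOf Z m ∧ Describes M c (π i) y m := by
    intro i
    induction i with
    | zero => exact fun _ => ⟨n, hnZ, h⟩
    | succ i ih =>
      intro hi
      obtain ⟨m, hm, hd⟩ := ih (by omega)
      obtain ⟨m', hd', hrg⟩ := exists_describes M hd.region (π (i + 1)) hd.lower hd.upper
      refine ⟨m', (hZ m hd.bound hm).2.2 m' hd'.bound ?_ ?_, hd'⟩
      · rw [← hrg]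
        refine hd.edge hd' ((hR m').2 ⟨hd'.bound, _, _, hd'⟩) (hz.trans_le (hπ i)) ?_
        exact fun χ hχ hy => Or.inr (Or.inr ⟨rfl, hrg.symm, (hd.above χ hχ).2 hy⟩)
      · rw [hd'.above φ hφ]
        refine hz.trans_le (PKS.le_val (π := fun j => π (i + 1 + j)) (h.pos.trans hz)
          (fun l => hπ _) ?_)
        rw [psat_of_fixed hfix]
        refine Or.inl ⟨j - (i + 1), ?_, fun l hl => hc _ (by omega)⟩
        simpa only [Nat.add_sub_cancel' hi] using hj
  obtain ⟨m, hm, hd⟩ := key j le_rfl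
  exact (hZ m hd.bound hm).2.1 ((hd.now_iff hφ).2 hj)

lemma afOK_describing {R : ℕ} (hR : ∀ n, bitOf R n ↔ n < nodeBound c ∧ describing M c n) :
    afOK c R := by
  intro k hk ψ hψ hfix hinf Z _ hZ n hn hnZ
  by_contra hcut
  obtain ⟨s, y, h⟩ := ((hR n).1 (hZ n hn hnZ).1).2
  have hK := gridOf_cast_pos c
  have start : ∃ z y, (k : ℝ) / gridOf c < z ∧ z < ((k : ℝ) + 1) / gridOf c ∧
      M.val M.sat s ψ < z ∧ Describes M c s y n ∧ (rg n = k → z ≤ y) := by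
    by_cases hrg : rg n = k
    · subst hrg
      obtain ⟨z, h1, h2, h3⟩ :=
        exists_gt_preserving (M.val M.sat s) (5 * (c + 1)) h.upper
      refine ⟨z, z, h.lower.trans h1, h2, lt_of_le_of_lt ?_ h1, ?_, fun _ => le_rfl⟩
      · by_contra! hlt
        exact hcut (Or.inl ⟨rfl, (h.above _ hψ).2 hlt⟩)
      · refine ⟨h.bound, h.region, h.lower.trans h1, h2, h.truth, fun φ hφ => ?_, h.grid⟩
        rw [h.above φ hφ]
        exact ⟨h3 φ hφ, h1.trans⟩
    · have hlt : M.val M.sat s ψ < ((k : ℝ) + 1) / gridOf c := by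
        by_contra! hle
        exact hcut (Or.inr ⟨hrg, (((h.grid _ hψ).2.2 k hk).2).2 hle⟩)
      have hlt' : (k : ℝ) / gridOf c < ((k : ℝ) + 1) / gridOf c := by gcongr; linarith
      obtain ⟨z, h1, h2⟩ := exists_between (max_lt hlt' hlt)
      exact ⟨z, y, (le_max_left _ _).trans_lt h1, h2, (le_max_right _ _).trans_lt h1, h,
        fun h => absurd h hrg⟩
  obtain ⟨z, y, hz1, hz2, hz3, h, hy⟩ := start
  let Inv : S × ℝ × ℕ → Prop := fun q =>
    bitOf Z q.2.2 ∧ Describes M c q.1 q.2.1 q.2.2 ∧ (rg q.2.2 = k → z ≤ q.2.1)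
  have step : ∀ q : {q // Inv q}, ∃ q' : {q // Inv q}, z ≤ M.P q.1.1 q'.1.1 := by
    rintro ⟨⟨t, x, m⟩, hmZ, hd, hx⟩
    obtain ⟨-, -, r, hr, k', hk', φ, hφ, hl, hdem, htrap⟩ := hZ m hd.bound hmZ
    have hzk : z < ((k' : ℝ) + 1) / gridOf c := by
      refine hz2.trans_le ?_
      have : k ≤ k' := by rcases hl with h | h <;> omega
      gcongr
    obtain ⟨t', x', m', hd', hch, hP, h1, h2⟩ := hd.exists_child hR hdem hzk
    have hrg : rg m' = k' := hch.1.2.1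
    have hzx : z ≤ x' := by
      rcases hl with hlt | ⟨rfl, hr0⟩
      · have := (grid_succ_le (c := c) hlt).trans_lt (hrg ▸ hd'.lower)
        exact (hz2.trans this).le
      · have : r = 1 ∨ r = 2 := by omega
        rcases this with rfl | rfl
        · exact (h1 rfl).le
        · have : rg m = k' := by
            rcases hdem.2.2.2.1 with h | h | h
            · omega
            · omega
            · exact h.2.1
          rw [h2 rfl]
          exact hx this
    exact ⟨⟨(t', x', m'), htrap m' hd'.bound hch, hd', fun _ => hzx⟩, hzx.trans hP.le⟩
  choose f hf using step
  let q : ℕ → {q // Inv q} := fun i => f^[i] ⟨(s, y, n), hnZ, h, hy⟩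
  refine hz3.not_ge (PKS.le_val (π := fun i => (q i).1.1)
    (lt_of_le_of_lt (by positivity) hz1) (fun i => ?_) ?_)
  · simp only [q, Function.iterate_succ_apply']
    exact hf _
  · rw [psat_of_fixed hfix]
    refine Or.inr ⟨hinf, fun i => ?_⟩
    obtain ⟨hq1, hq2, -⟩ := (q i).2
    exact (hq2.cont_iff hψ).1 (hZ _ hq2.bound hq1).2.1

end Describes

lemma accept_of_satisfiable {c : ℕ} (h : SFSatisfiable (stateOfCode c)) : Accept c := by
  obtain ⟨S, M, s, hs⟩ := h
  obtain ⟨R, hlt, hR⟩ := exists_bits (nodeBound c) (describing M c)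
  have hK := gridOf_cast_pos c
  refine ⟨R, hlt, ?_, fun n hn hnR => ?_, euOK_describing hR, afOK_describing hR⟩
  · obtain ⟨y, h1, h2⟩ : ∃ y : ℝ, ((0 : ℕ) : ℝ) / gridOf c < y ∧
        y < (((0 : ℕ) : ℝ) + 1) / gridOf c := exists_between (by gcongr; linarith)
    obtain ⟨n, hn, -⟩ := exists_describes M (gridOf_pos c) s h1 h2
    exact ⟨n, hn.bound, (hR n).2 ⟨hn.bound, s, y, hn⟩, (hn.truth c (by omega)).2 hs⟩
  · obtain ⟨-, s, y, hd⟩ := (hR n).1 hnR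
    refine ⟨hd.localOK, fun r _ k _ φ _ hdem => ?_⟩
    obtain ⟨t, y', n', hn', hch, -⟩ :=
      hd.exists_child hR hdem (z := 0) (by positivity)
    exact ⟨n', hn'.bound, hch⟩

/-! ### Ranks -/

lemma exists_uniform_bound {Q : ℕ → ℕ → Prop} (hQ : ∀ x i j, i ≤ j → Q x i → Q x j) (N : ℕ)
    (h : ∀ x < N, ∃ i, Q x i) : ∃ i, ∀ x < N, Q x i := by
  induction N with
  | zero => exact ⟨0, by simp⟩
  | succ N ih =>
    obtain ⟨i, hi⟩ := ih fun x hx => h x (by omega)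
    obtain ⟨j, hj⟩ := h N (by omega)
    refine ⟨max i j, fun x hx => ?_⟩
    rcases Nat.lt_succ_iff_lt_or_eq.1 hx with hlt | rfl
    · exact hQ _ _ _ (le_max_left _ _) (hi x hlt)
    · exact hQ _ _ _ (le_max_right _ _) hj

/-- The nodes from which `φ` can be fulfilled within `i` steps along witnesses. -/
def euStage (c R φ : ℕ) : ℕ → ℕ → Prop
  | 0, m => itemNow (tr m) φ
  | i + 1, m => itemNow (tr m) φ ∨ ∃ n', edge c R m 2 (rg m) n' ∧ bs n' φ ∧ euStage c R φ i n'

/-- The nodes where `ψ` can be refuted within `i` steps whatever live demand is followed. -/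
def afStage (c R k ψ : ℕ) : ℕ → ℕ → Prop
  | 0, m => ¬itemCont (tr m) ψ
  | i + 1, m => ¬itemCont (tr m) ψ ∨ ∀ r < 3, ∀ k' < gridOf c, ∀ φ < 5 * (c + 1),
      live k r k' → demand c m r k' φ → ∃ n', child c R m r k' φ n' ∧ afStage c R k ψ i n'

section Ranks

variable {c R : ℕ}

lemma afStage_mono {k ψ : ℕ} : ∀ {i j m : ℕ}, i ≤ j → afStage c R k ψ i m → afStage c R k ψ j m
  | 0, 0, _, _, h => h
  | 0, _ + 1, _, _, h => Or.inl h
  | _ + 1, _ + 1, _, hij, h => h.imp_right fun h r hr k' hk' φ hφ hl hd =>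
      (h r hr k' hk' φ hφ hl hd).imp fun _ hn =>
        ⟨hn.1, afStage_mono (Nat.le_of_succ_le_succ hij) hn.2⟩

lemma exists_euStage (hlt : R < 2 ^ nodeBound c) (h : euOK c R) {φ : ℕ} (hφ : φ < 5 * (c + 1))
    (hfix : itemNext φ = φ) (hinf : ¬itemInf φ) {n : ℕ} (hn : bitOf R n) (hb : bs n φ) :
    ∃ i, euStage c R φ i n := by
  obtain ⟨Z, hZ, hbit⟩ :=
    exists_bits (nodeBound c) fun m => bitOf R m ∧ ¬∃ i, euStage c R φ i m
  have hN := lt_of_bitOf hlt hn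
  by_contra hstage
  refine h φ hφ hfix hinf Z hZ ?_ n hN ((hbit n).2 ⟨hN, hn, hstage⟩) hb
  intro m _ hm
  obtain ⟨-, hmR, hms⟩ := (hbit m).1 hm
  refine ⟨hmR, fun hnow => hms ⟨0, hnow⟩, fun n' hn' he hb' =>
    (hbit n').2 ⟨hn', he.1, ?_⟩⟩
  rintro ⟨i, hi⟩
  exact hms ⟨i + 1, Or.inr ⟨n', he, hb', hi⟩⟩

lemma exists_afStage (hlt : R < 2 ^ nodeBound c) (h : afOK c R) {k ψ : ℕ} (hk : k < gridOf c)
    (hψ : ψ < 5 * (c + 1)) (hfix : itemNext ψ = ψ) (hinf : itemInf ψ) {n : ℕ} (hn : bitOf R n)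
    (hcut : ¬cut k n ψ) : ∃ i, afStage c R k ψ i n := by
  obtain ⟨Z, hZ, hbit⟩ :=
    exists_bits (nodeBound c) fun m => bitOf R m ∧ ¬∃ i, afStage c R k ψ i m
  have hN := lt_of_bitOf hlt hn
  by_contra hstage
  refine hcut (h k hk ψ hψ hfix hinf Z hZ ?_ n hN ((hbit n).2 ⟨hN, hn, hstage⟩))
  intro m _ hm
  obtain ⟨-, hmR, hms⟩ := (hbit m).1 hm
  refine ⟨hmR, not_not.1 fun hc => hms ⟨0, hc⟩, ?_⟩
  by_contra hfree
  refine hms ?_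
  suffices hs : ∃ i, ∀ r < 3, ∀ k' < gridOf c, ∀ φ < 5 * (c + 1),
      live k r k' → demand c m r k' φ → ∃ n', child c R m r k' φ n' ∧ afStage c R k ψ i n' by
    obtain ⟨i, hi⟩ := hs
    exact ⟨i + 1, Or.inr hi⟩
  have mono : ∀ r k' φ i j : ℕ, i ≤ j →
      (live k r k' → demand c m r k' φ → ∃ n', child c R m r k' φ n' ∧ afStage c R k ψ i n') →
      live k r k' → demand c m r k' φ → ∃ n', child c R m r k' φ n' ∧ afStage c R k ψ j n' :=
    fun r k' φ i j hij h hl hd => (h hl hd).imp fun n' hn' => ⟨hn'.1, afStage_mono hij hn'.2⟩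
  refine exists_uniform_bound (fun r i j hij h k' hk' φ hφ => mono r k' φ i j hij (h k' hk' φ hφ))
    _ fun r hr => ?_
  refine exists_uniform_bound (fun k' i j hij h φ hφ => mono r k' φ i j hij (h φ hφ))
    _ fun k' hk' => ?_
  refine exists_uniform_bound (fun φ i j hij h => mono r k' φ i j hij h) _ fun φ hφ => ?_
  by_cases hld : live k r k' ∧ demand c m r k' φ
  · by_contra hno
    refine hfree ⟨r, hr, k', hk', φ, hφ, hld.1, hld.2, fun n' hn' hch =>
      (hbit n').2 ⟨hn', hch.1.1, ?_⟩⟩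
    rintro ⟨i, hi⟩
    exact hno ⟨i, fun _ _ => ⟨n', hch, hi⟩⟩
  · exact ⟨0, fun hl hd => absurd ⟨hl, hd⟩ hld⟩

/-- `ρ` decreases along suitable witnesses of the item `φ` until `φ` is fulfilled. -/
def EuRank (c R φ : ℕ) (ρ : ℕ → ℕ) : Prop :=
  ∀ n, bitOf R n → bs n φ → ¬itemNow (tr n) φ →
    ∃ n', edge c R n 2 (rg n) n' ∧ bs n' φ ∧ ρ n' < ρ n

/-- For every live demand, `ρ` decreases along suitable witnesses as long as `ψ` is postponed. -/
def AfRank (c R k ψ : ℕ) (ρ : ℕ → ℕ) : Prop :=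
  ∀ n, bitOf R n → ¬cut k n ψ → itemCont (tr n) ψ → ∀ r k' φ, live k r k' → demand c n r k' φ →
    ∃ n', child c R n r k' φ n' ∧ ρ n' < ρ n

lemma exists_euRank (hlt : R < 2 ^ nodeBound c) (h : euOK c R) (φ : ℕ) : ∃ ρ,
    φ < 5 * (c + 1) → itemNext φ = φ → ¬itemInf φ → EuRank c R φ ρ := by
  refine ⟨fun m => sInf {i | euStage c R φ i m}, fun hφ hfix hinf n hn hb hnow => ?_⟩
  have hs := Nat.sInf_mem (s := {i | euStage c R φ i n})
    (exists_euStage hlt h hφ hfix hinf hn hb)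
  cases hi : sInf {i | euStage c R φ i n} with
  | zero =>
    rw [hi] at hs
    exact absurd hs hnow
  | succ i =>
    rw [hi] at hs
    obtain ⟨n', he, hb', hst⟩ := Or.resolve_left hs hnow
    refine ⟨n', he, hb', ?_⟩
    simp only [hi]
    exact Nat.lt_succ_of_le (Nat.sInf_le (s := {i | euStage c R φ i n'}) hst)

lemma exists_afRank (hlt : R < 2 ^ nodeBound c) (h : afOK c R) (k ψ : ℕ) : ∃ ρ,
    k < gridOf c → ψ < 5 * (c + 1) → itemNext ψ = ψ → itemInf ψ → AfRank c R k ψ ρ := by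
  refine ⟨fun m => sInf {i | afStage c R k ψ i m},
    fun hk hψ hfix hinf n hn hcut hc r k' φ hl hd => ?_⟩
  have hs := Nat.sInf_mem (s := {i | afStage c R k ψ i n})
    (exists_afStage hlt h hk hψ hfix hinf hn hcut)
  cases hi : sInf {i | afStage c R k ψ i n} with
  | zero =>
    rw [hi] at hs
    exact absurd hc hs
  | succ i =>
    rw [hi] at hs
    obtain ⟨n', hch, hst⟩ :=
      Or.resolve_left hs (not_not.2 hc) r hd.1 k' hd.2.1 φ hd.2.2.1 hl hd
    refine ⟨n', hch, ?_⟩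
    simp only [hi]
    exact Nat.lt_succ_of_le (Nat.sInf_le (s := {i | afStage c R k ψ i n'}) hst)

/-- A family of ranks containing one for every item and region. -/
def Ranks (c R : ℕ) (ρ : ℕ → ℕ → ℕ) : Prop :=
  (∀ φ < 5 * (c + 1), itemNext φ = φ → ¬itemInf φ → EuRank c R φ (ρ (Nat.pair 0 φ))) ∧
  ∀ k < gridOf c, ∀ ψ < 5 * (c + 1), itemNext ψ = ψ → itemInf ψ →
    AfRank c R k ψ (ρ (Nat.pair (k + 1) ψ))

lemma exists_ranks (h : R < 2 ^ nodeBound c) (hEU : euOK c R) (hAF : afOK c R) :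
    ∃ ρ, Ranks c R ρ := by
  choose ρ₁ h₁ using exists_euRank h hEU
  choose ρ₂ h₂ using exists_afRank h hAF
  refine ⟨fun e => if e.unpair.1 = 0 then ρ₁ e.unpair.2 else ρ₂ (e.unpair.1 - 1) e.unpair.2,
    fun φ hφ hfix hinf => ?_, fun k hk ψ hψ hfix hinf => ?_⟩
  · simpa using h₁ φ hφ hfix hinf
  · simpa using h₂ k ψ hk hψ hfix hinf

end Ranks

lemma not_eventually_decreasing {g : ℕ → ℕ} {j : ℕ} (h : ∀ i, g (j + i + 1) < g (j + i)) :
    False := by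
  have key : ∀ i, g (j + i) + i ≤ g j := by
    intro i
    induction i with
    | zero => simp
    | succ i ih => have := h i; rw [show j + (i + 1) = j + i + 1 from rfl]; omega
  have := key (g j + 1)
  omega

/-- Round-robin scheduling: if at each step either the scheduled rank decreases or the schedule
advances, then no rank can decrease whenever it is scheduled. -/
lemma no_scheduled_descent (ρ : ℕ → ℕ → ℕ) (m f : ℕ → ℕ) (e : ℕ)
    (h : ∀ j, (ρ (m j).unpair.1 (f (j + 1)) < ρ (m j).unpair.1 (f j) ∧ m (j + 1) = m j) ∨
      m (j + 1) = m j + 1)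
    (he : ∀ j, (m j).unpair.1 = e → ρ e (f (j + 1)) < ρ e (f j) ∧ m (j + 1) = m j) : False := by
  have adv : ∀ j, ∃ i, m i = m j + 1 := by
    intro j
    by_contra! hno
    have hc : ∀ i, m (j + i) = m j := by
      intro i
      induction i with
      | zero => rfl
      | succ i ih =>
        rcases h (j + i) with h' | h'
        · exact h'.2.trans ih
        · exact absurd (h'.trans (by rw [ih])) (hno _)
    refine not_eventually_decreasing (g := fun i => ρ (m j).unpair.1 (f i)) (j := j) fun i => ?_
    rcases h (j + i) with h' | h'
    · rw [hc i] at h'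
      exact h'.1
    · exact absurd (h'.trans (by rw [hc i])) (hno _)
  have all : ∀ d, ∃ i, m i = m 0 + d := by
    intro d
    induction d with
    | zero => exact ⟨0, rfl⟩
    | succ d ih =>
      obtain ⟨j, hj⟩ := ih
      obtain ⟨i, hi⟩ := adv j
      exact ⟨i, by omega⟩
  obtain ⟨j, hj⟩ := all (Nat.pair e (m 0) - m 0)
  rw [Nat.add_sub_cancel' (Nat.right_le_pair e (m 0))] at hj
  have hc : ∀ i, m (j + i) = Nat.pair e (m 0) := by
    intro i
    induction i with
    | zero => exact hj
    | succ i ih => exact (he (j + i) (by rw [ih]; simp)).2.trans ih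
  exact not_eventually_decreasing (g := fun i => ρ e (f i)) (j := j) fun i =>
    (he (j + i) (by rw [hc]; simp)).1

/-! ### The structure built from a certificate -/

/-- A state: a node together with a position in the schedule, a threshold in the region of the
node, and a margin separating thresholds from lower ends of regions. -/
structure Conf (c R : ℕ) where
  node : ℕ
  idx : ℕ
  thr : ℚ
  slack : ℚ
  mem : bitOf R node
  slack_pos : 0 < slack
  lower : (rg node : ℝ) / gridOf c + slack < thr
  upper : (thr : ℝ) < ((rg node : ℝ) + 1) / gridOf c

/-- `q'` may follow `q` as a witness of the demand of type `r` for `φ` in region `k`. -/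
structure Step {c R : ℕ} (ρ : ℕ → ℕ → ℕ) (q q' : Conf c R) (r k φ : ℕ) : Prop where
  dem : demand c q.node r k φ
  ch : child c R q.node r k φ q'.node
  sched : (ρ q.idx.unpair.1 q'.node < ρ q.idx.unpair.1 q.node ∧ q'.idx = q.idx) ∨
    ((¬∃ n', child c R q.node r k φ n' ∧ ρ q.idx.unpair.1 n' < ρ q.idx.unpair.1 q.node) ∧
      q'.idx = q.idx + 1)
  lowerEnd : r = 0 → q'.thr = k / gridOf c + q.slack ∧ q'.slack = q.slack / 2
  upperEnd : r = 1 → q'.slack = q.slack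
  same : r = 2 → q'.thr = q.thr ∧ q'.slack = q.slack

instance (c R : ℕ) : Countable (Conf c R) := by
  refine Function.Injective.countable
    (f := fun q : Conf c R => (q.node, q.idx, q.thr, q.slack)) fun q q' h => ?_
  cases q
  cases q'
  simpa using h

namespace Conf

variable {c R : ℕ} {ρ : ℕ → ℕ → ℕ} {q q' : Conf c R} {r k φ : ℕ}

lemma thr_pos (q : Conf c R) : (0 : ℝ) < q.thr := by
  have h1 := q.lower
  have h2 : (0 : ℝ) < q.slack := by exact_mod_cast q.slack_pos
  have h3 : (0 : ℝ) ≤ (rg q.node : ℝ) / gridOf c := by positivity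
  linarith

lemma slack_lt (q : Conf c R) : (q.slack : ℝ) < 1 / gridOf c := by
  have h1 := q.lower.trans q.upper
  rw [add_div] at h1
  linarith

lemma region (h : Step ρ q q' r k φ) : rg q'.node = k := h.ch.1.2.1

lemma slack_le (h : Step ρ q q' r k φ) : q'.slack ≤ q.slack := by
  have hr := h.dem.1
  have := q.slack_pos
  obtain rfl | rfl | rfl : r = 0 ∨ r = 1 ∨ r = 2 := by omega
  · rw [(h.lowerEnd rfl).2]; linarith
  · rw [h.upperEnd rfl]
  · rw [(h.same rfl).2]

lemma exists_step (hok : demandsOK c R q.node) (ρ : ℕ → ℕ → ℕ) (hd : demand c q.node r k φ)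
    {y l : ℚ} (hl : 0 < l) (h1 : (k : ℝ) / gridOf c + l < y)
    (h2 : (y : ℝ) < ((k : ℝ) + 1) / gridOf c)
    (h3 : r = 0 → y = k / gridOf c + q.slack ∧ l = q.slack / 2) (h4 : r = 1 → l = q.slack)
    (h5 : r = 2 → y = q.thr ∧ l = q.slack) :
    ∃ q' : Conf c R, Step ρ q q' r k φ ∧ q'.thr = y := by
  by_cases hdrop : ∃ n', child c R q.node r k φ n' ∧ ρ q.idx.unpair.1 n' < ρ q.idx.unpair.1 q.node
  · obtain ⟨n', hch, hlt⟩ := hdrop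
    have hrg : rg n' = k := hch.1.2.1
    exact ⟨⟨n', q.idx, y, l, hch.1.1, hl, by rwa [hrg], by rwa [hrg]⟩,
      ⟨hd, hch, Or.inl ⟨hlt, rfl⟩, h3, h4, h5⟩, rfl⟩
  · obtain ⟨n', -, hch⟩ := hok r hd.1 k hd.2.1 φ hd.2.2.1 hd
    have hrg : rg n' = k := hch.1.2.1
    exact ⟨⟨n', q.idx + 1, y, l, hch.1.1, hl, by rwa [hrg], by rwa [hrg]⟩,
      ⟨hd, hch, Or.inr ⟨hdrop, rfl⟩, h3, h4, h5⟩, rfl⟩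

lemma exists_step_lower (hok : demandsOK c R q.node) (ρ : ℕ → ℕ → ℕ)
    (hd : demand c q.node 0 k φ) :
    ∃ q', Step ρ q q' 0 k φ ∧ (k : ℝ) / gridOf c < q'.thr := by
  have hs : (0 : ℝ) < q.slack := by exact_mod_cast q.slack_pos
  obtain ⟨q', hq', hthr⟩ := exists_step hok ρ hd (y := k / gridOf c + q.slack)
    (l := q.slack / 2) (half_pos q.slack_pos) (by push_cast; linarith)
    (by have := q.slack_lt; push_cast; rw [add_div]; linarith) (by simp) (by simp) (by simp)
  refine ⟨q', hq', ?_⟩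
  rw [hthr]
  push_cast
  linarith

lemma exists_step_upper (hok : demandsOK c R q.node) (ρ : ℕ → ℕ → ℕ)
    (hd : demand c q.node 1 k φ) {z : ℝ} (hz : z < ((k : ℝ) + 1) / gridOf c) :
    ∃ q', Step ρ q q' 1 k φ ∧ z < q'.thr := by
  have hlt : (k : ℝ) / gridOf c + q.slack < ((k : ℝ) + 1) / gridOf c := by
    have := q.slack_lt
    rw [add_div]
    linarith
  obtain ⟨y, h1, h2⟩ := exists_rat_btwn (max_lt hz hlt)
  obtain ⟨q', hq', hthr⟩ := exists_step hok ρ hd (y := y) q.slack_pos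
    ((le_max_right _ _).trans_lt h1) h2 (by simp) (by simp) (by simp)
  exact ⟨q', hq', hthr ▸ (le_max_left _ _).trans_lt h1⟩

lemma exists_step_same (hok : demandsOK c R q.node) (ρ : ℕ → ℕ → ℕ)
    (hd : demand c q.node 2 (rg q.node) φ) :
    ∃ q', Step ρ q q' 2 (rg q.node) φ ∧ q'.thr = q.thr :=
  exists_step hok ρ hd q.slack_pos q.lower q.upper (by simp) (by simp) (by simp)

lemma no_descent {q : ℕ → Conf c R} {r k φ : ℕ → ℕ}
    (h : ∀ j, Step ρ (q j) (q (j + 1)) (r j) (k j) (φ j)) (e : ℕ)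
    (he : ∀ j, ∃ n', child c R (q j).node (r j) (k j) (φ j) n' ∧ ρ e n' < ρ e (q j).node) :
    False := by
  refine no_scheduled_descent ρ (fun j => (q j).idx) (fun j => (q j).node) e
    (fun j => (h j).sched.imp_right And.right) fun j hj => ?_
  have := (h j).sched
  rw [hj] at this
  exact this.resolve_right fun hn => hn.1 (he j)

lemma iterate_lt {C j : ℕ} (h : φ < 5 * C) : itemNext^[j] φ < 5 * C := by
  induction j with
  | zero => exact h
  | succ j ih => rw [Function.iterate_succ_apply']; exact itemNext_lt ih

lemma cut_of_step (hloc : localOK c q.node) (h : Step ρ q q' r k φ) {k₀ χ : ℕ}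
    (hk : k₀ < gridOf c) (hχ : χ < 5 * (c + 1)) (hc : itemCont (tr q.node) χ)
    (hl : live k₀ r k) (hcut : cut k₀ q'.node (itemNext χ)) : cut k₀ q.node χ := by
  obtain ⟨-, -, hgs⟩ := h.ch.1.2.2 χ hχ hc
  obtain ⟨hbs, hes, -⟩ := h.ch.1.2.2 χ hχ hc
  have hrg := region h
  have of_es : es q.node k₀ χ → cut k₀ q.node χ := fun he => by
    by_cases hk' : rg q.node = k₀
    · exact Or.inl ⟨hk', ((hloc.2.2.2 k₀ hk χ hχ).2.2 hk').1 he⟩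
    · exact Or.inr ⟨hk', he⟩
  rcases hl with hlt | ⟨rfl, hr0⟩
  · obtain ⟨h1, -⟩ | ⟨-, h2⟩ := hcut
    · omega
    · exact of_es (hes k₀ hlt h2)
  · obtain ⟨-, h1⟩ | ⟨h2, -⟩ := hcut
    · obtain ⟨h0, -⟩ | ⟨-, he⟩ | ⟨-, hb⟩ := hbs h1
      · exact absurd h0 hr0
      · exact of_es he
      · exact Or.inl hb
    · exact absurd hrg h2

lemma no_live_run (hloc : ∀ n, bitOf R n → localOK c n) (hρ : Ranks c R ρ)
    {q : ℕ → Conf c R} {r k φ : ℕ → ℕ} {k₀ ψ : ℕ}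
    (h : ∀ j, Step ρ (q j) (q (j + 1)) (r j) (k j) (φ j)) (hl : ∀ j, live k₀ (r j) (k j))
    (hk : k₀ < gridOf c) (hψ : ψ < 5 * (c + 1)) (hcut : ¬cut k₀ (q 0).node ψ) :
    ¬psat (fun j => tr (q j).node) ψ := by
  have inv : ∀ j, (∀ i < j, itemCont (tr (q i).node) (itemNext^[i] ψ)) →
      ¬cut k₀ (q j).node (itemNext^[j] ψ) := by
    intro j
    induction j with
    | zero => exact fun _ => hcut
    | succ j ih =>
      intro hc h'
      rw [Function.iterate_succ_apply'] at h'
      exact ih (fun i hi => hc i (by omega)) (cut_of_step (hloc _ (q j).mem) (h j) hk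
        (iterate_lt hψ) (hc j (by omega)) (hl j) h')
  rintro (⟨j, hnow, hc⟩ | ⟨hinf, hc⟩)
  · refine inv j hc ?_
    obtain ⟨h1, -, h2⟩ := (hloc _ (q j).mem).2.2.2 k₀ hk _ (iterate_lt (j := j) hψ)
    by_cases hrg : rg (q j).node = k₀
    · exact Or.inl ⟨hrg, (h2 hrg).1 (h1 hnow)⟩
    · exact Or.inr ⟨hrg, h1 hnow⟩
  · obtain ⟨J, hJ⟩ := exists_iterate_fixed ψ
    have hrank := hρ.2 k₀ hk _ (iterate_lt hψ) hJ ((itemInf_iterate ψ J).2 hinf)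
    refine no_descent (q := fun j => q (J + j)) (fun j => h (J + j))
      (Nat.pair (k₀ + 1) (itemNext^[J] ψ)) fun j => ?_
    have hfix : itemNext^[J + j] ψ = itemNext^[J] ψ := iterate_eq_of_fixed hJ (by omega)
    refine hrank _ (q (J + j)).mem ?_ ?_ _ _ _ (hl (J + j)) (h (J + j)).dem
    · rw [← hfix]
      exact inv _ fun i _ => hc i
    · rw [← hfix]
      exact hc _

end Conf

open Classical in
/-- The transition possibilities of the structure built from a certificate. -/
noncomputable def confP {c R : ℕ} (ρ : ℕ → ℕ → ℕ) (q q' : Conf c R) : ℝ :=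
  if ∃ r k φ, Step ρ q q' r k φ then q'.thr else 0

section Model

variable {c R : ℕ} {ρ : ℕ → ℕ → ℕ}

lemma confP_of_step {q q' : Conf c R} {r k φ : ℕ} (h : Step ρ q q' r k φ) :
    confP ρ q q' = q'.thr := if_pos ⟨r, k, φ, h⟩

lemma step_of_confP_pos {q q' : Conf c R} (h : 0 < confP ρ q q') :
    ∃ r k φ, Step ρ q q' r k φ := by
  by_contra hn
  rw [confP, if_neg hn] at h
  exact lt_irrefl _ h

lemma confP_le_one (hok : ∀ n, bitOf R n → localOK c n ∧ demandsOK c R n) (q q' : Conf c R) :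
    confP ρ q q' ≤ 1 := by
  unfold confP
  split_ifs
  · refine q'.upper.le.trans ?_
    rw [div_le_one (gridOf_cast_pos c)]
    exact_mod_cast (hok _ q'.mem).1.1
  · exact zero_le_one

lemma exists_lt_confP (hok : ∀ n, bitOf R n → localOK c n ∧ demandsOK c R n) (ρ : ℕ → ℕ → ℕ)
    (q : Conf c R) {y : ℝ} (hy : y < 1) : ∃ q', y < confP ρ q q' := by
  have hK := gridOf_pos c
  have hd : demand c q.node 1 (gridOf c - 1) 4 :=
    ⟨by omega, by omega, by omega, Or.inr (Or.inl ⟨rfl, (hok _ q.mem).1.2.2.1⟩),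
      itemNow_true _⟩
  obtain ⟨q', h1, h2⟩ := Conf.exists_step_upper (hok _ q.mem).2 ρ hd (z := y) (by
    rw [Nat.cast_sub hK, Nat.cast_one, sub_add_cancel, div_self (gridOf_cast_pos c).ne']
    exact hy)
  exact ⟨q', by rwa [confP_of_step h1]⟩

/-- The structure built from a certificate. -/
noncomputable def confModel (hok : ∀ n, bitOf R n → localOK c n ∧ demandsOK c R n)
    (ρ : ℕ → ℕ → ℕ) (q₀ : Conf c R) : PKS (Conf c R) ℕ where
  P := confP ρ
  init _ := 1
  L q := {b | tr q.node (Nat.pair 1 b)}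
  countable := inferInstance
  nonempty := ⟨q₀⟩
  P_nonneg q q' := by
    unfold confP
    split_ifs
    · exact q'.thr_pos.le
    · exact le_rfl
  P_le_one := confP_le_one hok
  P_sup q := by
    have : Nonempty (Conf c R) := ⟨q₀⟩
    refine le_antisymm (ciSup_le fun q' => confP_le_one hok q q') ?_
    refine le_of_forall_lt_imp_le_of_dense fun y hy => ?_
    obtain ⟨q', h⟩ := exists_lt_confP hok ρ q hy
    exact h.le.trans (le_ciSup ⟨1, by rintro _ ⟨t, rfl⟩; exact confP_le_one hok q t⟩ q')
  init_nonneg _ := zero_le_one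
  init_le_one _ := le_rfl
  init_sup := by
    have : Nonempty (Conf c R) := ⟨q₀⟩
    exact ciSup_const

variable {hok : ∀ n, bitOf R n → localOK c n ∧ demandsOK c R n} {q₀ q : Conf c R} {k φ : ℕ}

/-- The possibility of an item with respect to the truth values recorded in the nodes. -/
noncomputable abbrev nodeVal (hok : ∀ n, bitOf R n → localOK c n ∧ demandsOK c R n)
    (ρ : ℕ → ℕ → ℕ) (q₀ q : Conf c R) (φ : ℕ) : ℝ :=
  (confModel hok ρ q₀).val (fun q => tr q.node) q φ

lemma thr_le_one (hok : ∀ n, bitOf R n → localOK c n ∧ demandsOK c R n) (q : Conf c R) :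
    (q.thr : ℝ) ≤ 1 := by
  refine q.upper.le.trans ?_
  rw [div_le_one (gridOf_cast_pos c)]
  exact_mod_cast (hok _ q.mem).1.1

lemma thr_le_nodeVal (hρ : Ranks c R ρ) (hφ : φ < 5 * (c + 1)) (hb : bs q.node φ) :
    q.thr ≤ nodeVal hok ρ q₀ q φ := by
  by_contra! hlt
  let Inv : Conf c R × ℕ → Prop := fun x =>
    bs x.1.node x.2 ∧ x.2 < 5 * (c + 1) ∧ nodeVal hok ρ q₀ x.1 x.2 < x.1.thr
  have step : ∀ x : {x // Inv x}, ∃ x' : {x // Inv x},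
      Step ρ x.1.1 x'.1.1 2 (rg x.1.1.node) x.1.2 ∧ x'.1.1.thr = x.1.1.thr ∧
        x'.1.2 = itemNext x.1.2 ∧ ¬itemNow (tr x.1.1.node) x.1.2 := by
    rintro ⟨⟨p, χ⟩, hb, hχ, hv⟩
    have hnow : ¬itemNow (tr p.node) χ := fun hn => by
      have : nodeVal hok ρ q₀ p χ = 1 := PKS.val_of_now hn
      rw [this] at hv
      exact (thr_le_one hok p).not_gt hv
    obtain ⟨p', hs, hthr⟩ := Conf.exists_step_same (hok _ p.mem).2 ρ
      (⟨by omega, (hok _ p.mem).1.1, hχ, Or.inr (Or.inr ⟨rfl, rfl, hb⟩), hnow⟩ :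
        demand c p.node 2 (rg p.node) χ)
    refine ⟨⟨(p', itemNext χ), hs.ch.2.2, itemNext_lt hχ, ?_⟩, hs, hthr, rfl, hnow⟩
    by_contra! hle
    refine hv.not_ge (PKS.le_val_of_step hs.ch.2.1 (t := p') ?_ ?_)
    · exact (congrArg _ hthr).ge.trans (confP_of_step hs).ge
    · exact (congrArg _ hthr).ge.trans hle
  choose f hf using step
  let x : ℕ → {x // Inv x} := fun i => f^[i] ⟨(q, φ), hb, hφ, hlt⟩
  have hx : ∀ i, x (i + 1) = f (x i) := fun i => Function.iterate_succ_apply' _ _ _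
  have item : ∀ i, (x i).1.2 = itemNext^[i] φ := by
    intro i
    induction i with
    | zero => rfl
    | succ i ih => rw [hx, (hf _).2.2.1, ih, Function.iterate_succ_apply']
  have thr : ∀ i, (x i).1.1.thr = q.thr := by
    intro i
    induction i with
    | zero => rfl
    | succ i ih => rw [hx, (hf _).2.1, ih]
  have hstep : ∀ i, Step ρ (x i).1.1 (x (i + 1)).1.1 2 (rg (x i).1.1.node) (itemNext^[i] φ) := by
    intro i
    rw [hx, ← item]
    exact (hf (x i)).1
  have hcont : ∀ i, itemCont (tr (x i).1.1.node) (itemNext^[i] φ) := fun i => (hstep i).ch.2.1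
  by_cases hinf : itemInf φ
  · refine hlt.not_ge (PKS.le_val (M := confModel hok ρ q₀) (T := fun q => tr q.node)
      (π := fun i => (x i).1.1) q.thr_pos (fun i => ?_) (Or.inr ⟨hinf, hcont⟩))
    have : confP ρ (x i).1.1 (x (i + 1)).1.1 = q.thr := by
      rw [confP_of_step (hstep i), thr]
    exact this.ge
  · obtain ⟨J, hJ⟩ := exists_iterate_fixed φ
    have hrank := hρ.1 _ (Conf.iterate_lt hφ) hJ (fun h => hinf ((itemInf_iterate φ J).1 h))
    refine Conf.no_descent (q := fun j => (x (J + j)).1.1) (fun j => hstep (J + j))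
      (Nat.pair 0 (itemNext^[J] φ)) fun j => ?_
    have hfix : itemNext^[J + j] φ = itemNext^[J] φ := iterate_eq_of_fixed hJ (by omega)
    have hnow := (hf (x (J + j))).2.2.2
    have hbs := (x (J + j)).2.1
    have hct := hcont (J + j)
    rw [item, hfix] at hnow hbs
    rw [hfix] at hct
    obtain ⟨n', he, hb', hlt'⟩ := hrank _ (x (J + j)).1.1.mem hbs hnow
    refine ⟨n', ?_, hlt'⟩
    simp only [hfix]
    exact ⟨he, hct, by rwa [hJ]⟩

lemma lt_nodeVal_of_gs (hρ : Ranks c R ρ) (hk : k < gridOf c) (hφ : φ < 5 * (c + 1))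
    (hg : gs q.node k φ) : (k : ℝ) / gridOf c < nodeVal hok ρ q₀ q φ := by
  by_cases hnow : itemNow (tr q.node) φ
  · have : nodeVal hok ρ q₀ q φ = 1 := PKS.val_of_now hnow
    rw [this, div_lt_one (gridOf_cast_pos c)]
    exact_mod_cast hk
  · obtain ⟨q', hs, hlt⟩ := Conf.exists_step_lower (hok _ q.mem).2 ρ
      (⟨by omega, hk, hφ, Or.inl ⟨rfl, hg⟩, hnow⟩ : demand c q.node 0 k φ)
    exact hlt.trans_le (PKS.le_val_of_step (t := q') hs.ch.2.1 (confP_of_step hs).ge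
      (thr_le_nodeVal hρ (itemNext_lt hφ) hs.ch.2.2))

lemma le_nodeVal_of_es (hρ : Ranks c R ρ) (hk : k < gridOf c) (hφ : φ < 5 * (c + 1))
    (he : es q.node k φ) : ((k : ℝ) + 1) / gridOf c ≤ nodeVal hok ρ q₀ q φ := by
  by_cases hnow : itemNow (tr q.node) φ
  · have : nodeVal hok ρ q₀ q φ = 1 := PKS.val_of_now hnow
    rw [this, div_le_one (gridOf_cast_pos c)]
    exact_mod_cast hk
  · refine le_of_forall_lt_imp_le_of_dense fun z hz => ?_
    obtain ⟨q', hs, hlt⟩ := Conf.exists_step_upper (hok _ q.mem).2 ρ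
      (⟨by omega, hk, hφ, Or.inr (Or.inl ⟨rfl, he⟩), hnow⟩ : demand c q.node 1 k φ) hz
    exact hlt.le.trans (PKS.le_val_of_step (t := q') hs.ch.2.1 (confP_of_step hs).ge
      (thr_le_nodeVal hρ (itemNext_lt hφ) hs.ch.2.2))

lemma exists_run_of_lt_nodeVal {y : ℝ} (hy : 0 ≤ y) (h : y < nodeVal hok ρ q₀ q φ) :
    ∃ π : ℕ → Conf c R, ∃ r k' χ : ℕ → ℕ, ∃ z, y < z ∧ π 0 = q ∧
      (∀ i, Step ρ (π i) (π (i + 1)) (r i) (k' i) (χ i)) ∧ (∀ i, z ≤ (π (i + 1)).thr) ∧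
      psat (fun j => tr (π j).node) φ := by
  obtain ⟨π, z, hz, h0, hP, hψ⟩ := PKS.exists_path_of_lt_val hy h
  have hP' : ∀ i, z ≤ confP ρ (π i) (π (i + 1)) := hP
  choose r k' χ hs using fun i => step_of_confP_pos ((hy.trans_lt hz).trans_le (hP' i))
  exact ⟨π, r, k', χ, z, hz, h0, hs, fun i => (hP' i).trans (confP_of_step (hs i)).le, hψ⟩

lemma le_region_of_lt_thr {q' : Conf c R} {r k' χ : ℕ} (h : Step ρ q q' r k' χ)
    (hlt : (k : ℝ) / gridOf c < q'.thr) : k ≤ k' := by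
  by_contra! hk
  have h1 := q'.upper
  rw [Conf.region h] at h1
  exact (hlt.trans h1).not_ge (grid_succ_le hk)

lemma Conf.thr_of_lower {q' : Conf c R} {χ : ℕ} (h : Step ρ q q' 0 k χ) :
    (q'.thr : ℝ) = k / gridOf c + q.slack := by
  rw [(h.lowerEnd rfl).1]
  push_cast
  rfl

lemma nodeVal_lt_of_not_es (hρ : Ranks c R ρ) (hk : k < gridOf c) (hφ : φ < 5 * (c + 1))
    (he : ¬es q.node k φ) : nodeVal hok ρ q₀ q φ < ((k : ℝ) + 1) / gridOf c := by
  obtain ⟨β, hβ, h1, h2⟩ : ∃ β < ((k : ℝ) + 1) / gridOf c,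
      (k : ℝ) / gridOf c + q.slack ≤ β ∧ (rg q.node = k → (q.thr : ℝ) ≤ β) := by
    have hlt : (k : ℝ) / gridOf c + q.slack < ((k : ℝ) + 1) / gridOf c := by
      have := q.slack_lt
      rw [add_div]
      linarith
    by_cases hrg : rg q.node = k
    · exact ⟨_, max_lt hlt (hrg ▸ q.upper), le_max_left _ _, fun _ => le_max_right _ _⟩
    · exact ⟨_, hlt, le_rfl, fun h => absurd h hrg⟩
  have hs0 : (0 : ℝ) < q.slack := by exact_mod_cast q.slack_pos
  have hβ0 : (k : ℝ) / gridOf c < β := by linarith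
  refine lt_of_le_of_lt ?_ hβ
  by_contra! hlt
  obtain ⟨π, r, k', χ, z, hz, rfl, hs, hthr, hψ⟩ :=
    exists_run_of_lt_nodeVal (le_trans (by positivity) hβ0.le) hlt
  have hslack : ∀ i, (π i).slack ≤ (π 0).slack := by
    intro i
    induction i with
    | zero => exact le_rfl
    | succ i ih => exact (Conf.slack_le (hs i)).trans ih
  have hlive : ∀ i, live k (r i) (k' i) := by
    intro i
    have hgt := hz.trans_le (hthr i)
    rcases (le_region_of_lt_thr (hs i) (hβ0.trans hgt)).lt_or_eq with hlt | heq
    · exact Or.inl hlt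
    · refine Or.inr ⟨heq.symm, fun hr => ?_⟩
      have hsi := hs i
      rw [hr, ← heq] at hsi
      rw [Conf.thr_of_lower hsi] at hgt
      have : ((π i).slack : ℝ) ≤ (π 0).slack := by exact_mod_cast hslack i
      linarith
  have hloc := (hok _ (π 0).mem).1.2.2.2 k hk φ hφ
  rw [psat_unfold] at hψ
  obtain ⟨hc, hψ⟩ := hψ.resolve_left fun hn => he (hloc.1 hn)
  refine Conf.no_live_run (fun n hn => (hok n hn).1) hρ (fun j => hs (j + 1))
    (fun j => hlive (j + 1)) hk (itemNext_lt hφ) ?_ hψ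
  obtain ⟨hbs, hes, -⟩ := (hs 0).ch.1.2.2 φ hφ hc
  have hrg := Conf.region (hs 0)
  rintro (⟨h3, h4⟩ | ⟨h3, h4⟩)
  · rcases hbs h4 with ⟨hr, -⟩ | ⟨-, he'⟩ | ⟨hr, hrg', -⟩
    · rcases hlive 0 with hlt | ⟨-, hr'⟩
      · omega
      · exact hr' hr
    · rw [← hrg, h3] at he'
      exact he he'
    · have := h2 (by omega)
      have hgt := hz.trans_le (hthr 0)
      rw [((hs 0).same hr).1] at hgt
      exact this.not_gt hgt
  · rcases hlive 0 with hlt | ⟨heq, -⟩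
    · exact he (hes k hlt h4)
    · exact h3 (by omega)

lemma nodeVal_le_of_not_gs (hρ : Ranks c R ρ) (hk : k < gridOf c) (hφ : φ < 5 * (c + 1))
    (hg : ¬gs q.node k φ) : nodeVal hok ρ q₀ q φ ≤ (k : ℝ) / gridOf c := by
  by_contra! hlt
  obtain ⟨π, r, k', χ, z, hz, rfl, hs, hthr, hψ⟩ :=
    exists_run_of_lt_nodeVal (by positivity) hlt
  have hle : ∀ i, k ≤ k' i := fun i => le_region_of_lt_thr (hs i) (hz.trans_le (hthr i))
  have inv : ∀ j, (∀ i < j, itemCont (tr (π i).node) (itemNext^[i] φ)) →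
      ¬gs (π j).node k (itemNext^[j] φ) := by
    intro j
    induction j with
    | zero => exact fun _ => hg
    | succ j ih =>
      intro hc h'
      rw [Function.iterate_succ_apply'] at h'
      refine ih (fun i hi => hc i (by omega)) ?_
      exact ((hs j).ch.1.2.2 _ (Conf.iterate_lt hφ) (hc j (by omega))).2.2 k
        (Nat.lt_succ_of_le (hle j)) h'
  rcases hψ with ⟨j, hnow, hc⟩ | ⟨hinf, hc⟩
  · obtain ⟨h1, h2, -⟩ := (hok _ (π j).mem).1.2.2.2 k hk _ (Conf.iterate_lt (j := j) hφ)
    exact inv j hc (h2 (h1 hnow))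
  · have hfin : ∃ J, ∀ j, ¬(r (J + j) = 0 ∧ k' (J + j) = k) := by
      by_contra! hno
      have anti : Antitone fun i => ((π i).slack : ℝ) :=
        antitone_nat_of_succ_le fun i => by exact_mod_cast Conf.slack_le (hs i)
      have drop : ∀ d : ℕ, ∃ i,
          ((π i).slack : ℝ) + d * ((z - k / gridOf c) / 2) ≤ (π 0).slack := by
        intro d
        induction d with
        | zero => exact ⟨0, by simp⟩
        | succ d ih =>
          obtain ⟨J, hJ⟩ := ih
          obtain ⟨j, hr, hkj⟩ := hno J
          have hsj := hs (J + j)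
          rw [hr, hkj] at hsj
          have h1 := Conf.thr_of_lower hsj
          have h2 : ((π (J + j + 1)).slack : ℝ) = (π (J + j)).slack / 2 := by
            rw [(hsj.lowerEnd rfl).2]
            push_cast
            rfl
          have h3 := anti (Nat.le_add_right J j)
          have h4 := hthr (J + j)
          refine ⟨J + j + 1, ?_⟩
          simp only at h3
          push_cast
          linarith
      obtain ⟨d, hd⟩ := exists_nat_gt (((π 0).slack : ℝ) / ((z - k / gridOf c) / 2))
      obtain ⟨i, hi⟩ := drop d
      have hpos : (0 : ℝ) < (z - k / gridOf c) / 2 := by linarith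
      rw [div_lt_iff₀ hpos] at hd
      have : (0 : ℝ) < (π i).slack := by exact_mod_cast (π i).slack_pos
      linarith
    obtain ⟨J, hJ⟩ := hfin
    refine Conf.no_live_run (fun n hn => (hok n hn).1) hρ (q := fun j => π (J + j))
      (ψ := itemNext^[J] φ) (fun j => hs (J + j)) (fun j => ?_) hk (Conf.iterate_lt hφ) ?_
      (Or.inr ⟨(itemInf_iterate φ J).2 hinf, fun j => ?_⟩)
    · rcases (hle (J + j)).lt_or_eq with h | h
      · exact Or.inl h
      · exact Or.inr ⟨h.symm, fun hr => hJ j ⟨hr, h.symm⟩⟩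
    · have h0 := inv J fun i _ => hc i
      obtain ⟨-, h1, h2⟩ := (hok _ (π J).mem).1.2.2.2 k hk _ (Conf.iterate_lt (j := J) hφ)
      rintro (⟨h3, h4⟩ | ⟨-, h4⟩)
      · exact h0 ((h2 h3).2 h4)
      · exact h0 (h1 h4)
    · rw [← Function.iterate_add_apply, add_comm j J]
      exact hc _

lemma gridSpec_nodeVal (hρ : Ranks c R ρ) (hφ : φ < 5 * (c + 1)) :
    GridSpec c q.node φ (nodeVal hok ρ q₀ q φ) := by
  refine ⟨PKS.val_nonneg, PKS.val_le_one, fun k hk =>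
    ⟨⟨lt_nodeVal_of_gs hρ hk hφ, fun h => ?_⟩, ⟨le_nodeVal_of_es hρ hk hφ, fun h => ?_⟩⟩⟩
  · by_contra hn
    exact (nodeVal_le_of_not_gs hρ hk hφ hn).not_gt h
  · by_contra hn
    exact (nodeVal_lt_of_not_es hρ hk hφ hn).not_ge h

lemma tr_iff_sat (hρ : Ranks c R ρ) (a : ℕ) (ha : a < c + 1) (q : Conf c R) :
    tr q.node a ↔ (confModel hok ρ q₀).sat q a := by
  induction a using Nat.strong_induction_on generalizing q with
  | _ a ih =>
    by_cases h1 : tagOf a = 1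
    · have h : Nat.pair 1 (argOf a) = a := by rw [← h1, tagOf, argOf, Nat.pair_unpair]
      rw [PKS.sat, stateOfCode, if_pos h1, SF.Sat]
      change _ ↔ tr q.node (Nat.pair 1 (argOf a))
      rw [h]
    · refine (PKS.truthClause_iff ha (fun b hb => ih b hb (hb.trans ha) q) fun φ hφ => ?_).1
        ((hok _ q.mem).1.2.1 a ha) h1
      rw [PKS.val_congr (T' := fun q => tr q.node) fun q b hb =>
        (ih b (hb.trans_lt hφ) ((hb.trans_lt hφ).trans ha) q).symm]
      exact gridSpec_nodeVal hρ (item_lt_iff.2 (hφ.trans ha))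

end Model

lemma satisfiable_of_accept {c : ℕ} (h : Accept c) : SFSatisfiable (stateOfCode c) := by
  obtain ⟨R, hlt, ⟨n, -, hn, hc⟩, hcert, hEU, hAF⟩ := h
  have hok : ∀ n, bitOf R n → localOK c n ∧ demandsOK c R n := fun n hn =>
    hcert n (lt_of_bitOf hlt hn) hn
  obtain ⟨ρ, hρ⟩ := exists_ranks hlt hEU hAF
  have hK : (gridOf c : ℝ) ≠ 0 := (gridOf_cast_pos c).ne'
  have hK' : (0 : ℚ) < gridOf c := by exact_mod_cast gridOf_pos c
  have h0 : (0 : ℝ) < 1 / gridOf c := one_div_pos.2 (gridOf_cast_pos c)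
  let q₀ : Conf c R := ⟨n, 0, rg n / gridOf c + 3 / 4 * (1 / gridOf c), 1 / 2 * (1 / gridOf c), hn,
    by positivity, by push_cast; linarith, by push_cast; rw [add_div]; linarith⟩
  exact ⟨_, confModel hok ρ q₀, q₀, (tr_iff_sat hρ c (by omega) q₀).1 hc⟩

/-- **Theorem.** The satisfiability problem for PoCTL is decidable: for a fixed finite
set `A` of atomic propositions, there is a computable total (Boolean-valued) function
which, on the code of a PoCTL formula `Φ` over `A`, returns `true` iff `Φ` is
satisfiable. -/
theorem poctl_satisfiability_decidable (A : Type) [Fintype A] [Encodable A] :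
    ∃ f : ℕ → Bool, Computable f ∧ ∀ Φ : SF A, (f Φ.code = true ↔ SFSatisfiable Φ) := by
  obtain ⟨_, hprim⟩ := primrecPred_accept
  refine ⟨fun c => decide (Accept c), hprim.to_comp, fun Φ => ?_⟩
  rw [decide_eq_true_iff, ← satisfiable_encodeAtoms Φ, ← stateOfCode_code Φ.encodeAtoms,
    SF.code_encodeAtoms]
  exact ⟨satisfiable_of_accept, accept_of_satisfiable⟩
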